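/- Let G be a tidy (H₀,𝒫₀)-graph with tww(G) ≥ 3, let m = |𝒫₀|, and let G' be the trigraph obtained from G by shortening each path P ∈ 𝒫₀ with more than 8m vertices to length exactly 8m − 1. Then tww(G') ≤ tww(G) + 1. -/

import Mathlib

attribute [local instance] Classical.propDecidable

open Finset

universe u

/-- A trigraph: a finite graph whose edge set is partitioned into black and red edges. -/
structure Trigraph (V : Type u) where
  verts : Finset V
  black : Finset (Sym2 V)
  red : Finset (Sym2 V)
  black_nodiag : ∀ e ∈ black, ¬ e.IsDiag
  red_nodiag : ∀ e ∈ red, ¬ e.IsDiag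
  black_support : ∀ e ∈ black, ∀ x ∈ e, x ∈ verts
  red_support : ∀ e ∈ red, ∀ x ∈ e, x ∈ verts
  disj : Disjoint black red

namespace Trigraph

variable {V : Type u}

def BlackAdj (G : Trigraph V) (x y : V) : Prop := s(x, y) ∈ G.black
def RedAdj (G : Trigraph V) (x y : V) : Prop := s(x, y) ∈ G.red
def Adj (G : Trigraph V) (x y : V) : Prop := G.BlackAdj x y ∨ G.RedAdj x y

noncomputable def redDeg (G : Trigraph V) (x : V) : ℕ := (G.red.filter (fun e => x ∈ e)).card
noncomputable def blackDeg (G : Trigraph V) (x : V) : ℕ := (G.black.filter (fun e => x ∈ e)).card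
noncomputable def deg (G : Trigraph V) (x : V) : ℕ :=
  ((G.black ∪ G.red).filter (fun e => x ∈ e)).card
noncomputable def maxRedDeg (G : Trigraph V) : ℕ := G.verts.sup G.redDeg

/-- The black edges after contracting `v` into `u`. -/
noncomputable def cBlack (G : Trigraph V) (u v : V) : Finset (Sym2 V) :=
  G.black.filter (fun e => u ∉ e ∧ v ∉ e) ∪
    ((G.verts.erase v).filter
      (fun y => y ≠ u ∧ s(u, y) ∈ G.black ∧ s(v, y) ∈ G.black)).image (fun y => s(u, y))

/-- The red edges after contracting `v` into `u`. -/
noncomputable def cRed (G : Trigraph V) (u v : V) : Finset (Sym2 V) :=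
  G.red.filter (fun e => u ∉ e ∧ v ∉ e) ∪
    ((G.verts.erase v).filter
      (fun y => y ≠ u ∧ ¬(s(u, y) ∈ G.black ∧ s(v, y) ∈ G.black) ∧
        (s(u, y) ∈ G.red ∨ s(v, y) ∈ G.red ∨
          ¬((s(u, y) ∈ G.black) ↔ (s(v, y) ∈ G.black))))).image (fun y => s(u, y))

/-- Contraction of the two distinct vertices `u, v` of `G`: `v` is removed, `u` becomes the
new merged vertex; a black edge survives towards a common black neighbor, and a red edge is
created towards any other remaining neighbor of `u` or `v`. If `u = v` or one of them is not a
vertex, `G` is returned unchanged. -/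
noncomputable def contract (G : Trigraph V) (u v : V) : Trigraph V :=
  if h : u ≠ v ∧ u ∈ G.verts ∧ v ∈ G.verts then
    { verts := G.verts.erase v
      black := cBlack G u v
      red := cRed G u v
      black_nodiag := by
        intro e he
        rcases Finset.mem_union.1 he with he | he
        · exact G.black_nodiag e (Finset.mem_filter.1 he).1
        · obtain ⟨y, hy, rfl⟩ := Finset.mem_image.1 he
          have hyu : y ≠ u := ((Finset.mem_filter.1 hy).2).1
          simpa [Sym2.isDiag_iff_proj_eq] using fun hh => hyu (Eq.symm hh)
      red_nodiag := by
        intro e he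
        rcases Finset.mem_union.1 he with he | he
        · exact G.red_nodiag e (Finset.mem_filter.1 he).1
        · obtain ⟨y, hy, rfl⟩ := Finset.mem_image.1 he
          have hyu : y ≠ u := ((Finset.mem_filter.1 hy).2).1
          simpa [Sym2.isDiag_iff_proj_eq] using fun hh => hyu (Eq.symm hh)
      black_support := by
        intro e he x hx
        rcases Finset.mem_union.1 he with he | he
        · rcases Finset.mem_filter.1 he with ⟨heb, hu, hv⟩
          refine Finset.mem_erase.2 ⟨?_, G.black_support e heb x hx⟩
          rintro rfl; exact hv hx
        · obtain ⟨y, hy, rfl⟩ := Finset.mem_image.1 he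
          rcases Sym2.mem_iff.1 hx with rfl | rfl
          · exact Finset.mem_erase.2 ⟨h.1.symm ∘ Eq.symm, h.2.1⟩
          · exact (Finset.mem_filter.1 hy).1
      red_support := by
        intro e he x hx
        rcases Finset.mem_union.1 he with he | he
        · rcases Finset.mem_filter.1 he with ⟨heb, hu, hv⟩
          refine Finset.mem_erase.2 ⟨?_, G.red_support e heb x hx⟩
          rintro rfl; exact hv hx
        · obtain ⟨y, hy, rfl⟩ := Finset.mem_image.1 he
          rcases Sym2.mem_iff.1 hx with rfl | rfl
          · exact Finset.mem_erase.2 ⟨h.1.symm ∘ Eq.symm, h.2.1⟩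
          · exact (Finset.mem_filter.1 hy).1
      disj := by
        rw [Finset.disjoint_left]
        intro e heb her
        rcases Finset.mem_union.1 heb with heb | heb <;>
          rcases Finset.mem_union.1 her with her | her
        · exact Finset.disjoint_left.1 G.disj (Finset.mem_filter.1 heb).1
            (Finset.mem_filter.1 her).1
        · obtain ⟨y, hy, hey⟩ := Finset.mem_image.1 her
          exact ((Finset.mem_filter.1 heb).2).1 (hey ▸ Sym2.mem_mk_left u y)
        · obtain ⟨y, hy, hey⟩ := Finset.mem_image.1 heb
          exact ((Finset.mem_filter.1 her).2).1 (hey ▸ Sym2.mem_mk_left u y)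
        · obtain ⟨y, hy, hey⟩ := Finset.mem_image.1 heb
          obtain ⟨y', hy', hey'⟩ := Finset.mem_image.1 her
          have : y = y' := Sym2.congr_right.1 (hey.trans hey'.symm)
          subst this
          exact (((Finset.mem_filter.1 hy').2).2).1 ((Finset.mem_filter.1 hy).2).2 }
  else G

/-- The trigraph obtained from `G` by performing the contractions recorded in `ps`
(each pair `(u, v)` contracts `v` into `u`). -/
noncomputable def stage (G : Trigraph V) (ps : List (V × V)) : Trigraph V :=
  ps.foldl (fun H p => H.contract p.1 p.2) G

/-- The list `ps` records genuine contractions (distinct current vertices) starting from `G`. -/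
noncomputable def ValidSteps : Trigraph V → List (V × V) → Prop
  | _, [] => True
  | G, p :: ps =>
      p.1 ≠ p.2 ∧ p.1 ∈ G.verts ∧ p.2 ∈ G.verts ∧ ValidSteps (G.contract p.1 p.2) ps

/-- `ps` encodes a (complete) contraction sequence of `G`, ending in a one-vertex trigraph. -/
noncomputable def IsContractionSeq (G : Trigraph V) (ps : List (V × V)) : Prop :=
  ValidSteps G ps ∧ (stage G ps).verts.card = 1

/-- The width of the (partial) contraction sequence of `G` encoded by `ps`: the maximum red
degree appearing in any of its trigraphs. -/
noncomputable def seqWidth (G : Trigraph V) (ps : List (V × V)) : ℕ :=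
  ((List.range (ps.length + 1)).map (fun j => (stage G (ps.take j)).maxRedDeg)).foldr max 0

/-- The twin-width of a trigraph: the minimum width of a contraction sequence. -/
noncomputable def tww (G : Trigraph V) : ℕ :=
  sInf {t | ∃ ps, G.IsContractionSeq ps ∧ G.seqWidth ps ≤ t}

/-- Where the original vertex `x` currently lives after the contractions in `ps`. -/
noncomputable def collapse (ps : List (V × V)) (x : V) : V :=
  ps.foldl (fun y p => if y = p.2 then p.1 else y) x

/-- The bag of a vertex `u` after the contractions in `ps`: all original vertices of `G`
contracted into `u`. -/
noncomputable def bag (G : Trigraph V) (ps : List (V × V)) (u : V) : Finset V :=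
  G.verts.filter (fun x => collapse ps x = u)

/-- The induced subtrigraph on a vertex set `Q`. -/
noncomputable def induce (G : Trigraph V) (Q : Finset V) : Trigraph V where
  verts := G.verts ∩ Q
  black := G.black.filter (fun e => ∀ x ∈ e, x ∈ Q)
  red := G.red.filter (fun e => ∀ x ∈ e, x ∈ Q)
  black_nodiag := fun e he => G.black_nodiag e (Finset.mem_filter.1 he).1
  red_nodiag := fun e he => G.red_nodiag e (Finset.mem_filter.1 he).1
  black_support := fun e he x hx =>
    Finset.mem_inter.2 ⟨G.black_support e (Finset.mem_filter.1 he).1 x hx,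
      (Finset.mem_filter.1 he).2 x hx⟩
  red_support := fun e he x hx =>
    Finset.mem_inter.2 ⟨G.red_support e (Finset.mem_filter.1 he).1 x hx,
      (Finset.mem_filter.1 he).2 x hx⟩
  disj := Finset.disjoint_filter_filter G.disj

/-- The underlying simple graph of a trigraph (ignoring colors). -/
def toSimple (G : Trigraph V) : SimpleGraph V :=
  SimpleGraph.fromEdgeSet ↑(G.black ∪ G.red)

/-- A trigraph is connected if it is nonempty and all pairs of its vertices are joined by paths. -/
def Conn (G : Trigraph V) : Prop :=
  G.verts.Nonempty ∧ ∀ x ∈ G.verts, ∀ y ∈ G.verts, G.toSimple.Reachable x y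

/-- Distance from a vertex `x` to a set `A` of vertices. -/
noncomputable def distToSet (G : Trigraph V) (A : Finset V) (x : V) : ℕ :=
  sInf {d | ∃ a ∈ A, G.toSimple.dist x a = d}

end Trigraph

namespace Trigraph

variable {V : Type u}

/-- A dangling red path in `G`: a nonempty list of distinct vertices of `G`, with consecutive
vertices joined by red edges, in which every vertex has degree 2 in `G`. -/
def IsDanglingRedPath (G : Trigraph V) (p : List V) : Prop :=
  p ≠ [] ∧ p.Nodup ∧ p.Chain' G.RedAdj ∧ ∀ x ∈ p, x ∈ G.verts ∧ G.deg x = 2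

/-- `G` is a tidy `(H, 𝒫)`-graph (Definition 5): `G` is connected with `tww(G) ≥ 2`, `𝒫` is a
nonempty set of pairwise disjoint dangling red paths, `H` (given by its vertex set `HV`) and
the disjoint union `⊔𝒫` are disjoint induced subtrigraphs covering all of `G`, and every
vertex of `H` with a neighbor in `⊔𝒫` has black degree 0 and exactly that one neighbor
in `⊔𝒫`. -/
structure IsTidy (G : Trigraph V) (HV : Finset V) (P : Finset (List V)) : Prop where
  conn : G.Conn
  tww_ge : 2 ≤ G.tww
  Pne : P.Nonempty
  paths : ∀ p ∈ P, G.IsDanglingRedPath p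
  pathsDisj : ∀ p ∈ P, ∀ q ∈ P, p ≠ q → ∀ x ∈ p, x ∉ q
  Hsub : HV ⊆ G.verts
  Hdisj : ∀ p ∈ P, ∀ x ∈ p, x ∉ HV
  cover : ∀ x ∈ G.verts, x ∈ HV ∨ ∃ p ∈ P, x ∈ p
  pathsInduced : ∀ p ∈ P, ∀ x ∈ p, ∀ y ∈ p, G.Adj x y → ([x, y] <:+: p ∨ [y, x] <:+: p)
  noPathPathEdges : ∀ p ∈ P, ∀ q ∈ P, p ≠ q → ∀ x ∈ p, ∀ y ∈ q, ¬ G.Adj x y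
  boundary : ∀ u ∈ HV, ∀ v, (∃ p ∈ P, v ∈ p) → G.Adj u v →
    G.blackDeg u = 0 ∧ ∀ w, (∃ p ∈ P, w ∈ p) → G.Adj u w → w = v

/-- The part `H'` of a trigraph obtained from `G` by the contractions `ps`: the vertices
whose bag is contained in `HV`. -/
noncomputable def Hpart (G : Trigraph V) (HV : Finset V) (ps : List (V × V)) : Finset V :=
  (stage G ps).verts.filter (fun u => bag G ps u ⊆ HV)

/-- The vertex set of `F`: the vertices outside `H` at distance at most `2m` from `H`. -/
noncomputable def Fverts (G : Trigraph V) (HV : Finset V) (m : ℕ) : Finset V :=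
  (G.verts \ HV).filter (fun x => G.distToSet HV x ≤ 2 * m)

/-- The part `F'` of a trigraph obtained from `G` by the contractions `ps`: the vertices
whose bag is contained in `V(F)`. -/
noncomputable def Fpart (G : Trigraph V) (HV : Finset V) (m : ℕ) (ps : List (V × V)) :
    Finset V :=
  (stage G ps).verts.filter (fun u => bag G ps u ⊆ Fverts G HV m)

/-- The level of a vertex: the (common) distance from `H` in `G` of the vertices in its bag. -/
noncomputable def level (G : Trigraph V) (HV : Finset V) (ps : List (V × V)) (u : V) : ℕ :=
  sInf {d | ∃ x ∈ bag G ps u, G.distToSet HV x = d}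

/-- The connected component of `u` in the forest `F'`. -/
noncomputable def Fcomp (G : Trigraph V) (HV : Finset V) (m : ℕ) (ps : List (V × V)) (u : V) :
    Finset V :=
  (Fpart G HV m ps).filter
    (fun w => ((stage G ps).induce (Fpart G HV m ps)).toSimple.Reachable u w)

/-- The degree-3 vertices of the component of `u` in `F'`. -/
noncomputable def Fcomp3 (G : Trigraph V) (HV : Finset V) (m : ℕ) (ps : List (V × V)) (u : V) :
    Finset V :=
  (Fcomp G HV m ps u).filter (fun w => (stage G ps).deg w = 3)

/-- The trigraph reached from `G` by the contractions `ps` is `G`-tidy (Definition 7), for a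
tidy `(H, 𝒫)`-graph `G` with `m = |𝒫|`. -/
structure IsGTidy (G : Trigraph V) (HV : Finset V) (m : ℕ) (ps : List (V × V)) : Prop where
  valid : ValidSteps G ps
  basic : ∀ u ∈ (stage G ps).verts,
      u ∈ Hpart G HV ps ∨ u ∈ Fpart G HV m ps ∨ (bag G ps u).card = 1
  outs : ∀ u ∈ Hpart G HV ps,
      (((stage G ps).verts \ Hpart G HV ps).filter (fun v => (stage G ps).Adj u v)).card ≤ 1
  levels : ∀ u ∈ Fpart G HV m ps, ∀ x ∈ bag G ps u, ∀ y ∈ bag G ps u,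
      G.distToSet HV x = G.distToSet HV y
  forest : ((stage G ps).induce (Fpart G HV m ps)).toSimple.IsAcyclic
  deg_le : ∀ u ∈ Fpart G HV m ps, (stage G ps).deg u ≤ 3
  comp_cond : ∀ u ∈ Fpart G HV m ps,
      ∃ r ∈ Fcomp G HV m ps u, level G HV ps r = 1 ∧
        (∀ r' ∈ Fcomp G HV m ps u, level G HV ps r' = 1 → r' = r) ∧
        (∀ a ∈ Fcomp3 G HV m ps u, ∀ b ∈ Fcomp3 G HV m ps u,
          ((stage G ps).induce (Fcomp3 G HV m ps u)).toSimple.Reachable a b) ∧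
        (∀ w ∈ Fcomp3 G HV m ps u, level G HV ps w ≤ (bag G ps r).card - 1) ∧
        (Fcomp3 G HV m ps u = ∅ ∨ r ∈ Fcomp3 G HV m ps u)

end Trigraph

open Trigraph

namespace Trigraph

variable {V : Type u}

/-- Shortening a path with more than `8m` vertices to exactly `8m` vertices (length `8m - 1`):
keep the `4m` first and `4m` last vertices. -/
noncomputable def shortPath (m : ℕ) (p : List V) : List V :=
  if 8 * m < p.length then p.take (4 * m) ++ p.drop (p.length - 4 * m) else p

/-- The vertices surviving the shortening of the paths of `𝒫`. -/
noncomputable def shortenedVerts (HV : Finset V) (P : Finset (List V)) : Finset V :=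
  HV ∪ P.biUnion (fun p => (shortPath P.card p).toFinset)

/-- The new red edges joining the two halves of each shortened path. -/
noncomputable def joinEdges [Inhabited V] (P : Finset (List V)) : Finset (Sym2 V) :=
  (P.filter (fun p => 8 * P.card < p.length)).image
    (fun p => s(p.getD (4 * P.card - 1) default, p.getD (p.length - 4 * P.card) default))

/-- The trigraph obtained from a tidy `(H,𝒫)`-graph `G` by shortening each path of `𝒫` having
more than `8m` vertices (where `m = |𝒫|`) to length exactly `8m - 1`: the middle of each such
path is removed and the two remaining halves are joined by a red edge. -/
noncomputable def shorten [Inhabited V] (G : Trigraph V) (HV : Finset V)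
    (P : Finset (List V)) : Trigraph V where
  verts := G.verts ∩ shortenedVerts HV P
  black := G.black.filter (fun e => ∀ x ∈ e, x ∈ shortenedVerts HV P)
  red := G.red.filter (fun e => ∀ x ∈ e, x ∈ shortenedVerts HV P) ∪
    (joinEdges P).filter
      (fun e => ¬ e.IsDiag ∧ (∀ x ∈ e, x ∈ G.verts ∩ shortenedVerts HV P) ∧ e ∉ G.black)
  black_nodiag := fun e he => G.black_nodiag e (Finset.mem_filter.1 he).1
  red_nodiag := by
    intro e he
    rcases Finset.mem_union.1 he with he | he
    · exact G.red_nodiag e (Finset.mem_filter.1 he).1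
    · exact ((Finset.mem_filter.1 he).2).1
  black_support := fun e he x hx =>
    Finset.mem_inter.2 ⟨G.black_support e (Finset.mem_filter.1 he).1 x hx,
      (Finset.mem_filter.1 he).2 x hx⟩
  red_support := by
    intro e he x hx
    rcases Finset.mem_union.1 he with he | he
    · exact Finset.mem_inter.2 ⟨G.red_support e (Finset.mem_filter.1 he).1 x hx,
        (Finset.mem_filter.1 he).2 x hx⟩
    · exact (((Finset.mem_filter.1 he).2).2).1 x hx
  disj := by
    rw [Finset.disjoint_left]
    intro e hb hr
    have heb : e ∈ G.black := (Finset.mem_filter.1 hb).1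
    rcases Finset.mem_union.1 hr with hr | hr
    · exact Finset.disjoint_left.1 G.disj heb (Finset.mem_filter.1 hr).1
    · exact (((Finset.mem_filter.1 hr).2).2).2 heb

end Trigraph

namespace Trigraph

variable {V : Type u} {C : Type*} {C' : Type*}

/-! ### Quotients of trigraphs by colourings -/

/-- The colour classes of `x` and `y` in `S` are joined by a red edge in the quotient of `G`. -/
def QRed (G : Trigraph V) (S : Finset V) (c : V → C) (x y : V) : Prop :=
  c x ≠ c y ∧ (∃ x' ∈ S, ∃ y' ∈ S, c x' = c x ∧ c y' = c y ∧ G.Adj x' y') ∧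
    ∃ x' ∈ S, ∃ y' ∈ S, c x' = c x ∧ c y' = c y ∧ ¬ G.BlackAdj x' y'

/-- The quotient of `G` by the colour classes of `c` in `S` has maximum red degree at most `w`. -/
def QWidth (G : Trigraph V) (S : Finset V) (c : V → C) (w : ℕ) : Prop :=
  ∀ x ∈ S, ((S.filter (QRed G S c x)).image c).card ≤ w

/-- `c` and `d` have the same colour classes on `S`. -/
def SameKer (S : Finset V) (c : V → C) (d : V → C') : Prop :=
  ∀ x ∈ S, ∀ y ∈ S, c x = c y ↔ d x = d y

theorem card_image_le_of_ker {S : Finset V} {c : V → C} {d : V → C'}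
    (h : ∀ x ∈ S, ∀ y ∈ S, d x = d y → c x = c y) : (S.image c).card ≤ (S.image d).card := by
  refine Finset.card_le_card_of_forall_subsingleton (fun k l => ∃ x ∈ S, c x = k ∧ d x = l) ?_ ?_
  · intro k hk
    obtain ⟨x, hx, rfl⟩ := Finset.mem_image.1 hk
    exact ⟨d x, Finset.mem_image_of_mem _ hx, x, hx, rfl, rfl⟩
  · rintro l - k ⟨-, x, hx, rfl, hxl⟩ k' ⟨-, y, hy, rfl, hyl⟩
    exact h x hx y hy (hxl.trans hyl.symm)

theorem SameKer.qRed {G : Trigraph V} {S : Finset V} {c : V → C} {d : V → C'}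
    (h : SameKer S c d) {x y : V} (hx : x ∈ S) (hy : y ∈ S) :
    QRed G S c x y → QRed G S d x y := by
  rintro ⟨h1, ⟨a, ha, b, hb, hac, hbc, hab⟩, ⟨a', ha', b', hb', hac', hbc', hab'⟩⟩
  exact ⟨fun e => h1 ((h x hx y hy).2 e),
    ⟨a, ha, b, hb, (h _ ha _ hx).1 hac, (h _ hb _ hy).1 hbc, hab⟩,
    ⟨a', ha', b', hb', (h _ ha' _ hx).1 hac', (h _ hb' _ hy).1 hbc', hab'⟩⟩

theorem SameKer.symm {S : Finset V} {c : V → C} {d : V → C'} (h : SameKer S c d) :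
    SameKer S d c := fun x hx y hy => (h x hx y hy).symm

theorem QWidth.of_sameKer {G : Trigraph V} {S : Finset V} {c : V → C} {d : V → C'} {w : ℕ}
    (hw : QWidth G S c w) (h : SameKer S c d) : QWidth G S d w := by
  intro x hx
  have hf : S.filter (QRed G S d x) = S.filter (QRed G S c x) :=
    Finset.filter_congr fun y hy => ⟨h.symm.qRed hx hy, h.qRed hx hy⟩
  rw [hf]
  refine le_trans (card_image_le_of_ker ?_) (hw x hx)
  intro y hy z hz e
  exact (h y (Finset.mem_filter.1 hy).1 z (Finset.mem_filter.1 hz).1).1 e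

theorem QWidth.mono {G : Trigraph V} {S : Finset V} {c : V → C} {w w' : ℕ}
    (hw : QWidth G S c w) (h : w ≤ w') : QWidth G S c w' := fun x hx => (hw x hx).trans h

/-- Passing to a smaller vertex set does not increase the width of a quotient. -/
theorem QWidth.restrict {G G' : Trigraph V} {S A : Finset V} {c : V → C} {w : ℕ}
    (hw : QWidth G S c w) (hA : A ⊆ S)
    (hadj : ∀ x ∈ A, ∀ y ∈ A, G'.Adj x y → G.Adj x y)
    (hblack : ∀ x ∈ A, ∀ y ∈ A, G.BlackAdj x y → G'.BlackAdj x y) : QWidth G' A c w := by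
  intro x hx
  refine le_trans (Finset.card_le_card (Finset.image_subset_image ?_)) (hw x (hA hx))
  intro y hy
  obtain ⟨hyA, h1, ⟨a, ha, b, hb, hac, hbc, hab⟩, ⟨a', ha', b', hb', hac', hbc', hab'⟩⟩ :=
    Finset.mem_filter.1 hy
  exact Finset.mem_filter.2 ⟨hA hyA, h1, ⟨a, hA ha, b, hA hb, hac, hbc, hadj a ha b hb hab⟩,
    ⟨a', hA ha', b', hA hb', hac', hbc', fun h => hab' (hblack a' ha' b' hb' h)⟩⟩

/-- To bound the width of a quotient it suffices to bound the number of colours of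
neighbours of each class. -/
theorem qWidth_of_neighbours {G : Trigraph V} {S : Finset V} {c : V → C} {w : ℕ}
    (h : ∀ x ∈ S, ∃ K : Finset C, K.card ≤ w ∧ ∀ x' ∈ S, ∀ y ∈ S, c x' = c x → c y ≠ c x →
      G.Adj x' y → (∃ z ∈ S, ∃ z' ∈ S, c z = c x ∧ c z' = c y ∧ ¬ G.BlackAdj z z') → c y ∈ K) :
    QWidth G S c w := by
  intro x hx
  obtain ⟨K, hK, hKc⟩ := h x hx
  refine le_trans (Finset.card_le_card ?_) hK
  intro k hk
  obtain ⟨y, hy, rfl⟩ := Finset.mem_image.1 hk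
  obtain ⟨hyS, h1, ⟨a, ha, b, hb, hac, hbc, hab⟩, h3⟩ := Finset.mem_filter.1 hy
  rw [← hbc]
  exact hKc a ha b hb hac (fun e => h1 (e.symm.trans hbc)) hab (by rw [hbc]; exact h3)

/-! ### Contractions as quotients -/

theorem blackAdj_comm {G : Trigraph V} {x y : V} : G.BlackAdj x y ↔ G.BlackAdj y x := by
  unfold BlackAdj; rw [Sym2.eq_swap]

theorem redAdj_comm {G : Trigraph V} {x y : V} : G.RedAdj x y ↔ G.RedAdj y x := by
  unfold RedAdj; rw [Sym2.eq_swap]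

theorem adj_comm {G : Trigraph V} {x y : V} : G.Adj x y ↔ G.Adj y x := by
  unfold Adj; rw [blackAdj_comm, redAdj_comm]

theorem BlackAdj.mem_right {G : Trigraph V} {x y : V} (h : G.BlackAdj x y) : y ∈ G.verts :=
  G.black_support _ h _ (Sym2.mem_mk_right x y)

theorem RedAdj.mem_right {G : Trigraph V} {x y : V} (h : G.RedAdj x y) : y ∈ G.verts :=
  G.red_support _ h _ (Sym2.mem_mk_right x y)

theorem Adj.mem_right {G : Trigraph V} {x y : V} (h : G.Adj x y) : y ∈ G.verts :=
  h.elim BlackAdj.mem_right RedAdj.mem_right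

theorem Adj.ne {G : Trigraph V} {x y : V} (h : G.Adj x y) : x ≠ y := by
  rintro rfl
  rcases h with h | h
  · exact G.black_nodiag _ h (Sym2.mk_isDiag_iff.2 rfl)
  · exact G.red_nodiag _ h (Sym2.mk_isDiag_iff.2 rfl)

theorem redAdj_iff {G : Trigraph V} {x y : V} : G.RedAdj x y ↔ G.Adj x y ∧ ¬ G.BlackAdj x y :=
  ⟨fun h => ⟨Or.inr h, fun hb => Finset.disjoint_left.1 G.disj hb h⟩,
    fun h => h.1.resolve_left h.2⟩

theorem card_filter_mem_sym2 {E : Finset (Sym2 V)} {S : Finset V} {x : V}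
    (hS : ∀ y, s(x, y) ∈ E → y ∈ S) :
    (E.filter (fun e => x ∈ e)).card = (S.filter (fun y => s(x, y) ∈ E)).card := by
  have : E.filter (fun e => x ∈ e) = (S.filter (fun y => s(x, y) ∈ E)).image (fun y => s(x, y)) := by
    ext e
    simp only [Finset.mem_filter, Finset.mem_image]
    constructor
    · rintro ⟨he, hx⟩
      obtain ⟨y, rfl⟩ := hx
      exact ⟨y, ⟨hS y he, he⟩, rfl⟩
    · rintro ⟨y, ⟨-, hy⟩, rfl⟩
      exact ⟨hy, Sym2.mem_mk_left x y⟩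
  rw [this, Finset.card_image_of_injective]
  intro y z h
  exact Sym2.congr_right.1 h

theorem redDeg_eq (G : Trigraph V) (x : V) :
    G.redDeg x = (G.verts.filter (fun y => G.RedAdj x y)).card := by
  unfold redDeg
  rw [card_filter_mem_sym2 (S := G.verts) fun _ h => RedAdj.mem_right h]
  congr 1
  ext y
  rw [Finset.mem_filter, Finset.mem_filter]
  rfl

theorem deg_eq (G : Trigraph V) (x : V) :
    G.deg x = (G.verts.filter (fun y => G.Adj x y)).card := by
  unfold deg
  rw [card_filter_mem_sym2 (S := G.verts)]
  · congr 1
    ext y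
    rw [Finset.mem_filter, Finset.mem_filter, Finset.mem_union]
    rfl
  · intro y h
    rcases Finset.mem_union.1 h with h | h
    · exact BlackAdj.mem_right h
    · exact RedAdj.mem_right h

section contract

variable {G : Trigraph V} {u v : V}

theorem contract_verts (h : u ≠ v) (hu : u ∈ G.verts) (hv : v ∈ G.verts) :
    (G.contract u v).verts = G.verts.erase v := by
  simp [contract, h, hu, hv]

theorem contract_black (h : u ≠ v) (hu : u ∈ G.verts) (hv : v ∈ G.verts) :
    (G.contract u v).black = cBlack G u v := by
  simp [contract, h, hu, hv]

theorem contract_red (h : u ≠ v) (hu : u ∈ G.verts) (hv : v ∈ G.verts) :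
    (G.contract u v).red = cRed G u v := by
  simp [contract, h, hu, hv]

theorem contract_blackAdj_of_ne (h : u ≠ v) (hu : u ∈ G.verts) (hv : v ∈ G.verts) {y z : V}
    (hy : y ≠ u) (hz : z ≠ u) (hyv : y ≠ v) (hzv : z ≠ v) :
    (G.contract u v).BlackAdj y z ↔ G.BlackAdj y z := by
  unfold BlackAdj
  rw [contract_black h hu hv, cBlack]
  simp only [Finset.mem_union, Finset.mem_filter, Finset.mem_image, Sym2.mem_iff, Sym2.eq_iff]
  grind

theorem contract_redAdj_of_ne (h : u ≠ v) (hu : u ∈ G.verts) (hv : v ∈ G.verts) {y z : V}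
    (hy : y ≠ u) (hz : z ≠ u) (hyv : y ≠ v) (hzv : z ≠ v) :
    (G.contract u v).RedAdj y z ↔ G.RedAdj y z := by
  unfold RedAdj
  rw [contract_red h hu hv, cRed]
  simp only [Finset.mem_union, Finset.mem_filter, Finset.mem_image, Sym2.mem_iff, Sym2.eq_iff]
  grind

theorem contract_adj_of_ne (h : u ≠ v) (hu : u ∈ G.verts) (hv : v ∈ G.verts) {y z : V}
    (hy : y ≠ u) (hz : z ≠ u) (hyv : y ≠ v) (hzv : z ≠ v) :
    (G.contract u v).Adj y z ↔ G.Adj y z := by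
  unfold Adj
  rw [contract_blackAdj_of_ne h hu hv hy hz hyv hzv, contract_redAdj_of_ne h hu hv hy hz hyv hzv]

theorem contract_blackAdj_left (h : u ≠ v) (hu : u ∈ G.verts) (hv : v ∈ G.verts) {z : V}
    (hz : z ≠ u) (hzv : z ≠ v) :
    (G.contract u v).BlackAdj u z ↔ G.BlackAdj u z ∧ G.BlackAdj v z := by
  have hm : G.BlackAdj u z → z ∈ G.verts := BlackAdj.mem_right
  unfold BlackAdj at *
  rw [contract_black h hu hv, cBlack]
  simp only [Finset.mem_union, Finset.mem_filter, Finset.mem_image, Sym2.mem_iff, Sym2.eq_iff]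
  grind

theorem contract_adj_left (h : u ≠ v) (hu : u ∈ G.verts) (hv : v ∈ G.verts) {z : V}
    (hz : z ≠ u) (hzv : z ≠ v) :
    (G.contract u v).Adj u z ↔ G.Adj u z ∨ G.Adj v z := by
  have hm1 : G.Adj u z → z ∈ G.verts := Adj.mem_right
  have hm2 : G.Adj v z → z ∈ G.verts := Adj.mem_right
  have hb := contract_blackAdj_left h hu hv hz hzv
  have hr : (G.contract u v).RedAdj u z ↔ z ∈ G.verts ∧
      ¬ (G.BlackAdj u z ∧ G.BlackAdj v z) ∧ (G.RedAdj u z ∨ G.RedAdj v z ∨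
        ¬ (G.BlackAdj u z ↔ G.BlackAdj v z)) := by
    unfold RedAdj BlackAdj
    rw [contract_red h hu hv, cRed]
    simp only [Finset.mem_union, Finset.mem_filter, Finset.mem_image, Finset.mem_erase]
    constructor
    · rintro (⟨-, h1, -⟩ | ⟨y, ⟨⟨-, h1⟩, -, h2⟩, h3⟩)
      · exact (h1 (Sym2.mem_mk_left u z)).elim
      · rw [← Sym2.congr_right.1 h3]
        exact ⟨h1, h2⟩
    · rintro ⟨h1, h2⟩
      exact Or.inr ⟨z, ⟨⟨hzv, h1⟩, hz, h2⟩, rfl⟩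
  unfold Adj at *
  rw [hb, hr]
  clear hb hr
  tauto

end contract

/-- `K` is the quotient of `G` by the map `f`, the class of `x` being named `f x`. -/
structure IsQuotient (G : Trigraph V) (f : V → V) (K : Trigraph V) : Prop where
  verts : K.verts = G.verts.image f
  adj : ∀ x ∈ G.verts, ∀ y ∈ G.verts, K.Adj (f x) (f y) ↔
    f x ≠ f y ∧ ∃ x' ∈ G.verts, ∃ y' ∈ G.verts, f x' = f x ∧ f y' = f y ∧ G.Adj x' y'
  black : ∀ x ∈ G.verts, ∀ y ∈ G.verts, K.BlackAdj (f x) (f y) ↔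
    f x ≠ f y ∧ ∀ x' ∈ G.verts, ∀ y' ∈ G.verts, f x' = f x → f y' = f y → G.BlackAdj x' y'

theorem isQuotient_id (G : Trigraph V) : IsQuotient G id G where
  verts := by simp
  adj x hx y hy := by
    constructor
    · intro h
      exact ⟨h.ne, x, hx, y, hy, rfl, rfl, h⟩
    · rintro ⟨-, x', -, y', -, rfl, rfl, h⟩
      exact h
  black x hx y hy := by
    constructor
    · intro h
      refine ⟨Adj.ne (Or.inl h), ?_⟩
      rintro x' - y' - rfl rfl
      exact h
    · rintro ⟨-, h⟩
      exact h x hx y hy rfl rfl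

theorem IsQuotient.redAdj {G K : Trigraph V} {f : V → V} (h : IsQuotient G f K) {x y : V}
    (hx : x ∈ G.verts) (hy : y ∈ G.verts) : K.RedAdj (f x) (f y) ↔ QRed G G.verts f x y := by
  rw [redAdj_iff, h.adj x hx y hy, h.black x hx y hy, QRed]
  push Not
  constructor
  · rintro ⟨⟨h1, h2⟩, h3⟩
    exact ⟨h1, h2, h3 h1⟩
  · rintro ⟨h1, h2, h3⟩
    exact ⟨⟨h1, h2⟩, fun _ => h3⟩

theorem IsQuotient.redDeg {G K : Trigraph V} {f : V → V} (h : IsQuotient G f K) {x : V}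
    (hx : x ∈ G.verts) :
    K.redDeg (f x) = ((G.verts.filter (QRed G G.verts f x)).image f).card := by
  rw [redDeg_eq, h.verts]
  congr 1
  ext k
  simp only [Finset.mem_filter, Finset.mem_image]
  constructor
  · rintro ⟨⟨y, hy, rfl⟩, hr⟩
    exact ⟨y, ⟨hy, (h.redAdj hx hy).1 hr⟩, rfl⟩
  · rintro ⟨y, ⟨hy, hr⟩, rfl⟩
    exact ⟨⟨y, hy, rfl⟩, (h.redAdj hx hy).2 hr⟩

theorem IsQuotient.maxRedDeg_le_iff {G K : Trigraph V} {f : V → V} (h : IsQuotient G f K)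
    {w : ℕ} : K.maxRedDeg ≤ w ↔ QWidth G G.verts f w := by
  unfold maxRedDeg QWidth
  rw [Finset.sup_le_iff, h.verts]
  constructor
  · intro H x hx
    rw [← h.redDeg hx]
    exact H _ (Finset.mem_image_of_mem f hx)
  · intro H k hk
    obtain ⟨x, hx, rfl⟩ := Finset.mem_image.1 hk
    rw [h.redDeg hx]
    exact H x hx

end Trigraph

namespace Trigraph

variable {V : Type u} {C : Type*} {C' : Type*}

theorem IsQuotient.contract {G K : Trigraph V} {f : V → V} (h : IsQuotient G f K) {u v : V}
    (huv : u ≠ v) (hu : u ∈ K.verts) (hv : v ∈ K.verts) :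
    IsQuotient G (fun x => if f x = v then u else f x) (K.contract u v) := by
  obtain ⟨a, ha, hau⟩ := Finset.mem_image.1 (h.verts ▸ hu)
  obtain ⟨b, hb, hbv⟩ := Finset.mem_image.1 (h.verts ▸ hv)
  set g : V → V := fun x => if f x = v then u else f x with hg
  have gu : ∀ x, g x = u ↔ f x = u ∨ f x = v := fun x => by simp only [hg]; grind
  have gne : ∀ x, g x ≠ u → g x = f x ∧ f x ≠ u ∧ f x ≠ v := fun x => by simp only [hg]; grind
  have gcl : ∀ x, g x ≠ u → ∀ x', g x' = g x ↔ f x' = f x := fun x => by simp only [hg]; grind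
  have adjL : ∀ x ∈ G.verts, ∀ y ∈ G.verts, g x = u → g y ≠ u →
      ((K.contract u v).Adj (g x) (g y) ↔ ∃ x' ∈ G.verts, ∃ y' ∈ G.verts,
        g x' = g x ∧ g y' = g y ∧ G.Adj x' y') := by
    intro x hx y hy hgx hgy
    obtain ⟨h1, h2, h3⟩ := gne y hgy
    have ea := h.adj a ha y hy
    have eb := h.adj b hb y hy
    rw [hau] at ea
    rw [hbv] at eb
    simp only [gcl y hgy, hgx, gu]
    rw [h1, contract_adj_left huv hu hv h2 h3, ea, eb]
    constructor
    · rintro (⟨-, x', hx', y', hy', e⟩ | ⟨-, x', hx', y', hy', e⟩)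
      · exact ⟨x', hx', y', hy', Or.inl e.1, e.2⟩
      · exact ⟨x', hx', y', hy', Or.inr e.1, e.2⟩
    · rintro ⟨x', hx', y', hy', e | e, e'⟩
      · exact Or.inl ⟨h2.symm, x', hx', y', hy', e, e'⟩
      · exact Or.inr ⟨h3.symm, x', hx', y', hy', e, e'⟩
  have blackL : ∀ x ∈ G.verts, ∀ y ∈ G.verts, g x = u → g y ≠ u →
      ((K.contract u v).BlackAdj (g x) (g y) ↔ ∀ x' ∈ G.verts, ∀ y' ∈ G.verts,
        g x' = g x → g y' = g y → G.BlackAdj x' y') := by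
    intro x hx y hy hgx hgy
    obtain ⟨h1, h2, h3⟩ := gne y hgy
    have ea := h.black a ha y hy
    have eb := h.black b hb y hy
    rw [hau] at ea
    rw [hbv] at eb
    simp only [gcl y hgy, hgx, gu]
    rw [h1, contract_blackAdj_left huv hu hv h2 h3, ea, eb]
    constructor
    · rintro ⟨⟨-, e1⟩, ⟨-, e2⟩⟩ x' hx' y' hy' (e | e) e'
      · exact e1 x' hx' y' hy' e e'
      · exact e2 x' hx' y' hy' e e'
    · intro e
      exact ⟨⟨h2.symm, fun x' hx' y' hy' e1 e2 => e x' hx' y' hy' (Or.inl e1) e2⟩,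
        ⟨h3.symm, fun x' hx' y' hy' e1 e2 => e x' hx' y' hy' (Or.inr e1) e2⟩⟩
  refine ⟨?_, ?_, ?_⟩
  · rw [contract_verts huv hu hv, h.verts]
    ext k
    simp only [Finset.mem_erase, Finset.mem_image]
    constructor
    · rintro ⟨hk, x, hx, rfl⟩
      exact ⟨x, hx, if_neg hk⟩
    · rintro ⟨x, hx, rfl⟩
      by_cases hxv : f x = v
      · simp only [hg, if_pos hxv]
        exact ⟨huv, a, ha, hau⟩
      · simp only [hg, if_neg hxv]
        exact ⟨hxv, x, hx, rfl⟩
  · intro x hx y hy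
    by_cases hxy : g x = g y
    · constructor
      · intro e
        exact (e.ne hxy).elim
      · intro e
        exact (e.1 hxy).elim
    rw [and_iff_right (show g x ≠ g y from hxy)]
    by_cases hxu : g x = u
    · exact adjL x hx y hy hxu (fun e => hxy (hxu.trans e.symm))
    by_cases hyu : g y = u
    · rw [adj_comm, adjL y hy x hx hyu hxu]
      constructor
      · rintro ⟨x', hx', y', hy', e1, e2, e3⟩
        exact ⟨y', hy', x', hx', e2, e1, adj_comm.1 e3⟩
      · rintro ⟨x', hx', y', hy', e1, e2, e3⟩
        exact ⟨y', hy', x', hx', e2, e1, adj_comm.1 e3⟩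
    · simp only [gcl x hxu, gcl y hyu]
      obtain ⟨h1, h2, h3⟩ := gne x hxu
      obtain ⟨h1', h2', h3'⟩ := gne y hyu
      rw [h1, h1', contract_adj_of_ne huv hu hv h2 h2' h3 h3', h.adj x hx y hy, and_iff_right]
      rwa [h1, h1'] at hxy
  · intro x hx y hy
    by_cases hxy : g x = g y
    · constructor
      · intro e
        exact (Adj.ne (Or.inl e) hxy).elim
      · intro e
        exact (e.1 hxy).elim
    rw [and_iff_right (show g x ≠ g y from hxy)]
    by_cases hxu : g x = u
    · exact blackL x hx y hy hxu (fun e => hxy (hxu.trans e.symm))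
    by_cases hyu : g y = u
    · rw [blackAdj_comm, blackL y hy x hx hyu hxu]
      constructor
      · intro H x' hx' y' hy' e1 e2
        exact blackAdj_comm.1 (H y' hy' x' hx' e2 e1)
      · intro H x' hx' y' hy' e1 e2
        exact blackAdj_comm.1 (H y' hy' x' hx' e2 e1)
    · simp only [gcl x hxu, gcl y hyu]
      obtain ⟨h1, h2, h3⟩ := gne x hxu
      obtain ⟨h1', h2', h3'⟩ := gne y hyu
      rw [h1, h1', contract_blackAdj_of_ne huv hu hv h2 h2' h3 h3', h.black x hx y hy,
        and_iff_right]
      rwa [h1, h1'] at hxy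

theorem collapse_append_singleton (ps : List (V × V)) (p : V × V) (x : V) :
    collapse (ps ++ [p]) x = if collapse ps x = p.2 then p.1 else collapse ps x := by
  unfold collapse
  rw [List.foldl_append]
  rfl

theorem stage_append_singleton (G : Trigraph V) (ps : List (V × V)) (p : V × V) :
    stage G (ps ++ [p]) = (stage G ps).contract p.1 p.2 := by
  simp [stage, List.foldl_append]

theorem validSteps_append (G : Trigraph V) (ps qs : List (V × V)) :
    ValidSteps G (ps ++ qs) ↔ ValidSteps G ps ∧ ValidSteps (stage G ps) qs := by
  induction ps generalizing G with
  | nil => simp [ValidSteps, stage]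
  | cons p ps ih =>
    simp only [List.cons_append, ValidSteps, ih, stage, List.foldl_cons]
    tauto

theorem isQuotient_stage {G : Trigraph V} {ps : List (V × V)} (h : ValidSteps G ps) :
    IsQuotient G (collapse ps) (stage G ps) := by
  induction ps using List.reverseRecOn with
  | nil => exact isQuotient_id G
  | append_singleton ps p ih =>
    obtain ⟨h1, h2, h3, h4, -⟩ := (validSteps_append G ps [p]).1 h
    have := (ih h1).contract h2 h3 h4
    rw [stage_append_singleton]
    convert this using 1
    funext x
    exact collapse_append_singleton ps p x

theorem seqWidth_le_iff {G : Trigraph V} {ps : List (V × V)} {w : ℕ} :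
    G.seqWidth ps ≤ w ↔ ∀ j ≤ ps.length, (stage G (ps.take j)).maxRedDeg ≤ w := by
  have key : ∀ l : List ℕ, l.foldr max 0 ≤ w ↔ ∀ a ∈ l, a ≤ w := by
    intro l
    induction l with
    | nil => simp
    | cons a l ih => simp [ih]
  simp [seqWidth, key]

/-- `c'` arises from `c` by replacing the colour `a` by the colour `b`, for some `a`, `b`. -/
def Recolours (S : Finset V) (c c' : V → C) : Prop :=
  ∃ a b, ∀ x ∈ S, c' x = if c x = a then b else c x

theorem Recolours.of_eqOn {S : Finset V} {c c' : V → C} (h : ∀ x ∈ S, c' x = c x)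
    (a : C) : Recolours S c c' := by
  refine ⟨a, a, fun x hx => ?_⟩
  rw [h x hx]
  split_ifs with e
  · exact e
  · rfl

/-- A recolouring step leading to a colouring of width at most `w`. -/
def RecolourStep (G : Trigraph V) (w : ℕ) (c c' : V → C) : Prop :=
  Recolours G.verts c c' ∧ QWidth G G.verts c' w

/-- `c'` is obtained from `c` by recolouring steps of width at most `w`. -/
def RecolourSeq (G : Trigraph V) (w : ℕ) : (V → C) → (V → C) → Prop :=
  Relation.ReflTransGen (RecolourStep G w)

theorem RecolourSeq.exists_steps {G : Trigraph V} {w : ℕ} {c c' : V → C}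
    (h : RecolourSeq G w c c') (hc : Set.InjOn c G.verts) (hw : QWidth G G.verts c w) :
    ∃ ps, ValidSteps G ps ∧ G.seqWidth ps ≤ w ∧ SameKer G.verts c' (collapse ps) := by
  induction h with
  | refl =>
    refine ⟨[], trivial, ?_, ?_⟩
    · rw [seqWidth_le_iff]
      intro j hj
      rw [List.take_nil, show stage G [] = G from rfl, (isQuotient_id G).maxRedDeg_le_iff]
      exact hw.of_sameKer fun x hx y hy => ⟨fun e => hc hx hy e, fun e => congrArg c e⟩
    · exact fun x hx y hy => ⟨fun e => hc hx hy e, fun e => congrArg c e⟩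
  | @tail d d' _ hstep ih =>
    obtain ⟨ps, hval, hwid, hker⟩ := ih
    obtain ⟨⟨a, b, hab⟩, hw'⟩ := hstep
    by_cases hex : a ≠ b ∧ (∃ x ∈ G.verts, d x = a) ∧ ∃ y ∈ G.verts, d y = b
    · obtain ⟨hne, ⟨x, hx, rfl⟩, ⟨y, hy, rfl⟩⟩ := hex
      have hcol : ∀ z ∈ G.verts, ∀ z' ∈ G.verts, d z = d z' ↔ collapse ps z = collapse ps z' := hker
      have hval' : ValidSteps G (ps ++ [(collapse ps y, collapse ps x)]) := by
        rw [validSteps_append]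
        refine ⟨hval, ?_, ?_, ?_, trivial⟩
        · exact fun e => hne ((hker x hx y hy).2 e.symm)
        · rw [(isQuotient_stage hval).verts]
          exact Finset.mem_image_of_mem _ hy
        · rw [(isQuotient_stage hval).verts]
          exact Finset.mem_image_of_mem _ hx
      have hker' : SameKer G.verts d' (collapse (ps ++ [(collapse ps y, collapse ps x)])) := by
        intro z hz z' hz'
        rw [hab z hz, hab z' hz', collapse_append_singleton, collapse_append_singleton]
        have e1 := hker z hz x hx
        have e2 := hker z' hz' x hx
        have e3 := hker z hz y hy
        have e4 := hker z' hz' y hy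
        have e5 := hker z hz z' hz'
        simp only
        grind
      refine ⟨_, hval', ?_, hker'⟩
      rw [seqWidth_le_iff] at hwid ⊢
      intro j hj
      rcases Nat.lt_or_ge ps.length j with hlt | hle
      · rw [List.take_of_length_le (by simp; omega), (isQuotient_stage hval').maxRedDeg_le_iff]
        exact hw'.of_sameKer hker'
      · rw [List.take_append_of_le_length hle]
        exact hwid j hle
    · refine ⟨ps, hval, hwid, ?_⟩
      intro z hz z' hz'
      rw [← hker z hz z' hz', hab z hz, hab z' hz']
      by_contra hcon
      apply hex
      refine ⟨?_, ?_, ?_⟩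
      · rintro rfl
        grind
      · by_contra hx
        push Not at hx
        rw [if_neg (hx z hz), if_neg (hx z' hz')] at hcon
        exact hcon Iff.rfl
      · by_contra hy
        push Not at hy
        have := hy z hz
        have := hy z' hz'
        grind

theorem tww_le_of_recolourSeq {G : Trigraph V} {w : ℕ} {c c' : V → C}
    (hne : G.verts.Nonempty) (hc : Set.InjOn c G.verts) (hw : QWidth G G.verts c w)
    (h : RecolourSeq G w c c') (hc' : ∀ x ∈ G.verts, ∀ y ∈ G.verts, c' x = c' y) :
    G.tww ≤ w := by
  obtain ⟨ps, hval, hwid, hker⟩ := h.exists_steps hc hw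
  refine Nat.sInf_le ⟨ps, ⟨hval, ?_⟩, hwid⟩
  rw [(isQuotient_stage hval).verts, Finset.card_eq_one]
  obtain ⟨x, hx⟩ := hne
  refine ⟨collapse ps x, ?_⟩
  ext k
  simp only [Finset.mem_image, Finset.mem_singleton]
  constructor
  · rintro ⟨y, hy, rfl⟩
    exact (hker y hy x hx).1 (hc' y hy x hx)
  · rintro rfl
    exact ⟨x, hx, rfl⟩

/-- A trigraph of positive twin-width has a sequence of colourings witnessing it. -/
theorem exists_colourings {G : Trigraph V} (hpos : 0 < G.tww) :
    ∃ (c : ℕ → V → V) (L : ℕ), c 0 = id ∧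
      (∀ s, ∃ a b, ∀ x, c (s + 1) x = if c s x = a then b else c s x) ∧
      (∀ s, QWidth G G.verts (c s) G.tww) ∧ ∀ x ∈ G.verts, ∀ y ∈ G.verts, c L x = c L y := by
  have hne : {t | ∃ ps, G.IsContractionSeq ps ∧ G.seqWidth ps ≤ t}.Nonempty := by
    by_contra h
    rw [Set.not_nonempty_iff_eq_empty] at h
    unfold tww at hpos
    rw [h] at hpos
    simp at hpos
  obtain ⟨ps, ⟨hval, hcard⟩, hwid⟩ := Nat.sInf_mem hne
  have hwid : G.seqWidth ps ≤ G.tww := hwid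
  refine ⟨fun s => collapse (ps.take s), ps.length, rfl, ?_, ?_, ?_⟩
  · intro s
    rcases Nat.lt_or_ge s ps.length with hs | hs
    · refine ⟨ps[s].2, ps[s].1, fun x => ?_⟩
      simp only
      rw [List.take_succ_eq_append_getElem hs, collapse_append_singleton]
    · obtain ⟨x, -⟩ := Finset.card_pos.1 (by omega : 0 < (stage G ps).verts.card)
      refine ⟨x, x, fun y => ?_⟩
      simp only
      rw [List.take_of_length_le hs, List.take_of_length_le (by omega)]
      split_ifs with e
      · exact e
      · rfl
  · intro s
    have hval' : ValidSteps G (ps.take s) := by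
      rw [← List.take_append_drop s ps, validSteps_append] at hval
      exact hval.1
    rw [← (isQuotient_stage hval').maxRedDeg_le_iff]
    rcases Nat.lt_or_ge ps.length s with hs | hs
    · have := seqWidth_le_iff.1 hwid ps.length le_rfl
      rw [List.take_length] at this
      rwa [List.take_of_length_le hs.le]
    · exact seqWidth_le_iff.1 hwid s hs
  · intro x hx y hy
    simp only
    rw [List.take_length]
    rw [(isQuotient_stage hval).verts] at hcard
    exact Finset.card_le_one.1 hcard.le _ (Finset.mem_image_of_mem _ hx) _
      (Finset.mem_image_of_mem _ hy)

end Trigraph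

namespace Trigraph

variable {V : Type u}

/-! ### Trigraphs consisting of a core with long tails attached -/

/-- `G` consists of a core `A` together with `n` tails of `D` vertices each. Tail `i` is attached
to the vertex `b i` of the core; the vertex `v` of a tail belongs to the tail `en v`, at distance
`lev v` from the core. The last vertices of the tails `2 i` and `2 i + 1` may be adjacent. -/
structure IsTailed (G : Trigraph V) (A : Finset V) (n D : ℕ) (lev en : V → ℕ) (b : ℕ → V) :
    Prop where
  core_subset : A ⊆ G.verts
  root_mem : ∀ i < n, b i ∈ A
  root_inj : ∀ i < n, ∀ j < n, b i = b j → i = j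
  range : ∀ v ∈ G.verts, v ∉ A → en v < n ∧ 1 ≤ lev v ∧ lev v ≤ D
  inj : ∀ v ∈ G.verts, v ∉ A → ∀ w ∈ G.verts, w ∉ A → en v = en w → lev v = lev w → v = w
  adj_tail : ∀ v ∈ G.verts, v ∉ A → ∀ w ∈ G.verts, w ∉ A → G.Adj v w →
    (en v = en w ∧ (lev w = lev v + 1 ∨ lev v = lev w + 1)) ∨
      (lev v = D ∧ lev w = D ∧ en v / 2 = en w / 2 ∧ en v ≠ en w)
  adj_core : ∀ v ∈ G.verts, v ∉ A → ∀ w ∈ A, G.Adj v w → lev v = 1 ∧ w = b (en v)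

/-- The label of the vertex of tail `i` at level `p`: tails smaller than `j`, and the part of
tail `j` at levels at least `q`, are identified according to the colouring `c (T p)` of their
roots; all other vertices remain alone. -/
noncomputable def tailLabel (b : ℕ → V) (c : ℕ → V → V) (T : ℕ → ℕ) (j q p i : ℕ) : V ⊕ ℕ :=
  if i < j ∨ (i = j ∧ q ≤ p) then Sum.inl (c (T p) (b i)) else Sum.inr i

/-- The colouring of a tailed trigraph given by `c (T 0)` on the core and by `tailLabel` on each
level of the tails. -/
noncomputable def tailColour (A : Finset V) (lev en : V → ℕ) (b : ℕ → V) (c : ℕ → V → V)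
    (T : ℕ → ℕ) (j q : ℕ) (v : V) : V ⊕ (ℕ × (V ⊕ ℕ)) :=
  if v ∈ A then Sum.inl (c (T 0) v) else Sum.inr (lev v, tailLabel b c T j q (lev v) (en v))

variable {b : ℕ → V} {c : ℕ → V → V} {T : ℕ → ℕ} {j q p i i' : ℕ}

theorem tailLabel_pos (h : i < j ∨ (i = j ∧ q ≤ p)) :
    tailLabel b c T j q p i = Sum.inl (c (T p) (b i)) := if_pos h

theorem tailLabel_neg (h : ¬ (i < j ∨ (i = j ∧ q ≤ p))) :
    tailLabel b c T j q p i = Sum.inr i := if_neg h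

theorem tailLabel_eq_of_neg (h : ¬ (i < j ∨ (i = j ∧ q ≤ p)))
    (he : tailLabel b c T j q p i' = tailLabel b c T j q p i) : i' = i := by
  rw [tailLabel_neg h] at he
  unfold tailLabel at he
  split_ifs at he
  exact Sum.inr_injective he

theorem tailLabel_eq_of_pos (h : i < j ∨ (i = j ∧ q ≤ p))
    (he : tailLabel b c T j q p i' = tailLabel b c T j q p i) :
    (i' < j ∨ (i' = j ∧ q ≤ p)) ∧ c (T p) (b i') = c (T p) (b i) := by
  rw [tailLabel_pos h] at he
  unfold tailLabel at he
  split_ifs at he with h'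
  exact ⟨h', Sum.inl_injective he⟩

variable {G : Trigraph V} {A : Finset V} {n D : ℕ} {lev en : V → ℕ}

theorem tailColour_of_mem {v : V} (h : v ∈ A) :
    tailColour A lev en b c T j q v = Sum.inl (c (T 0) v) := if_pos h

theorem tailColour_of_notMem {v : V} (h : v ∉ A) :
    tailColour A lev en b c T j q v = Sum.inr (lev v, tailLabel b c T j q (lev v) (en v)) :=
  if_neg h

theorem tailColour_eq_of_mem {v w : V} (h : v ∈ A)
    (he : tailColour A lev en b c T j q w = tailColour A lev en b c T j q v) :
    w ∈ A ∧ c (T 0) w = c (T 0) v := by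
  rw [tailColour_of_mem h] at he
  unfold tailColour at he
  split_ifs at he with h'
  exact ⟨h', Sum.inl_injective he⟩

theorem tailColour_eq_of_notMem {v w : V} (h : v ∉ A)
    (he : tailColour A lev en b c T j q w = tailColour A lev en b c T j q v) :
    w ∉ A ∧ lev w = lev v ∧
      tailLabel b c T j q (lev v) (en w) = tailLabel b c T j q (lev v) (en v) := by
  rw [tailColour_of_notMem h] at he
  unfold tailColour at he
  split_ifs at he with h'
  have h1 := Prod.mk.inj (Sum.inr_injective he)
  refine ⟨h', h1.1, ?_⟩
  rw [← h1.2, h1.1]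

theorem card_insert_singleton_le_two {C : Type*} (k l : C) : ({k} ∪ {l} : Finset C).card ≤ 2 :=
  (Finset.card_union_le _ _).trans (by simp)

/-- The colouring `tailColour` has width at most `max (t + 1) 4`, provided that the colourings of
consecutive levels refine each other slowly enough. -/
theorem IsTailed.qWidth_tailColour (hG : IsTailed G A n D lev en b) {t : ℕ}
    (hc0 : Set.InjOn (c 0) A) (hw : QWidth G A (c (T 0)) t)
    (htop : ∀ i < n, ∀ i' < n, c (T D) (b i) = c (T D) (b i'))
    (hmono : ∀ p < D, ∀ i < n, ∀ i' < n, c (T p) (b i) = c (T p) (b i') →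
      c (T (p + 1)) (b i) = c (T (p + 1)) (b i'))
    (hsplit : ∀ p < D, ∀ γ, (((Finset.range n).filter (fun i => c (T (p + 1)) (b i) = γ)).image
      (fun i => c (T p) (b i))).card ≤ 2)
    (hproc : T 0 = 0 ∨ n ≤ j) :
    QWidth G G.verts (tailColour A lev en b c T j q) (max (t + 1) 4) := by
  apply qWidth_of_neighbours
  intro x hx
  by_cases hxA : x ∈ A
  · refine ⟨((A.filter (QRed G A (c (T 0)) x)).image (c (T 0))).image Sum.inl ∪
      (G.verts.filter (fun y => y ∉ A ∧ lev y = 1 ∧ c (T 0) (b (en y)) = c (T 0) x)).image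
        (tailColour A lev en b c T j q), ?_, ?_⟩
    · refine le_trans (Finset.card_union_le _ _) (le_trans ?_ (le_max_left _ _))
      refine Nat.add_le_add (le_trans Finset.card_image_le (hw x hxA)) ?_
      rw [Finset.card_le_one]
      intro k hk l hl
      obtain ⟨y, hy, rfl⟩ := Finset.mem_image.1 hk
      obtain ⟨z, hz, rfl⟩ := Finset.mem_image.1 hl
      obtain ⟨hy, hyA, hy1, hyc⟩ := Finset.mem_filter.1 hy
      obtain ⟨hz, hzA, hz1, hzc⟩ := Finset.mem_filter.1 hz
      obtain ⟨hyn, -, hyD⟩ := hG.range y hy hyA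
      obtain ⟨hzn, -, -⟩ := hG.range z hz hzA
      rcases hproc with h0 | hnj
      · rw [h0] at hyc hzc
        have := hc0 (hG.root_mem _ hyn) (hG.root_mem _ hzn) (hyc.trans hzc.symm)
        have := hG.root_inj _ hyn _ hzn this
        rw [hG.inj y hy hyA z hz hzA this (hy1.trans hz1.symm)]
      · rw [tailColour_of_notMem hyA, tailColour_of_notMem hzA, hy1, hz1,
          tailLabel_pos (by omega), tailLabel_pos (by omega),
          hmono 0 (by omega) _ hyn _ hzn (hyc.trans hzc.symm)]
    · rintro x' hx' y hy hxx' hne hadj ⟨z, hz, z', hz', hzx, hzy, hzz⟩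
      obtain ⟨hx'A, hx'c⟩ := tailColour_eq_of_mem hxA hxx'
      by_cases hyA : y ∈ A
      · refine Finset.mem_union_left _ ?_
        rw [tailColour_of_mem hyA]
        refine Finset.mem_image_of_mem _ (Finset.mem_image_of_mem _
          (Finset.mem_filter.2 ⟨hyA, ?_, ⟨x', hx'A, y, hyA, hx'c, rfl, hadj⟩, ?_⟩))
        · intro e
          exact hne (by rw [tailColour_of_mem hxA, tailColour_of_mem hyA, e])
        · obtain ⟨hzA, hzc⟩ := tailColour_eq_of_mem hxA hzx
          obtain ⟨hzA', hzc'⟩ := tailColour_eq_of_mem hyA hzy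
          exact ⟨z, hzA, z', hzA', hzc, hzc', hzz⟩
      · refine Finset.mem_union_right _ (Finset.mem_image_of_mem _
          (Finset.mem_filter.2 ⟨hy, hyA, ?_⟩))
        obtain ⟨h1, h2⟩ := hG.adj_core y hy hyA x' hx'A (adj_comm.1 hadj)
        exact ⟨h1, by rw [← h2, hx'c]⟩
  · obtain ⟨hxn, hx1, hxD⟩ := hG.range x hx hxA
    have up : ∃ k, ∀ x' ∈ G.verts, ∀ y ∈ G.verts,
        tailColour A lev en b c T j q x' = tailColour A lev en b c T j q x →
        tailColour A lev en b c T j q y ≠ tailColour A lev en b c T j q x → x' ∉ A → y ∉ A →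
        ((en x' = en y ∧ lev y = lev x' + 1) ∨
          (lev x' = D ∧ lev y = D ∧ en x' / 2 = en y / 2 ∧ en x' ≠ en y)) →
        tailColour A lev en b c T j q y = k := by
      rcases Nat.lt_or_ge (lev x) D with hlt | hge
      · refine ⟨Sum.inr (lev x + 1, tailLabel b c T j q (lev x + 1) (en x)), ?_⟩
        rintro x' hx' y hy hxx' - hx'A hyA hor
        obtain ⟨-, hl, hlab⟩ := tailColour_eq_of_notMem hxA hxx'
        obtain ⟨hen, hly⟩ : en x' = en y ∧ lev y = lev x + 1 := by
          rcases hor with h | h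
          · exact ⟨h.1, by omega⟩
          · omega
        rw [tailColour_of_notMem hyA, hly, ← hen]
        by_cases hp : en x < j ∨ (en x = j ∧ q ≤ lev x)
        · obtain ⟨hp', hcc⟩ := tailLabel_eq_of_pos hp hlab
          rw [tailLabel_pos (by omega), tailLabel_pos (by omega),
            hmono _ hlt _ (hG.range x' hx' hx'A).1 _ hxn hcc]
        · rw [tailLabel_eq_of_neg hp hlab]
      · by_cases hp : en x < j ∨ (en x = j ∧ q ≤ lev x)
        · refine ⟨Sum.inr (D, Sum.inr (if q ≤ D then j + 1 else j)), ?_⟩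
          rintro x' hx' y hy hxx' hne hx'A hyA hor
          obtain ⟨-, hl, hlab⟩ := tailColour_eq_of_notMem hxA hxx'
          obtain ⟨hp', hcc⟩ := tailLabel_eq_of_pos hp hlab
          have hyr := hG.range y hy hyA
          obtain ⟨hly, hen, hen'⟩ : lev y = D ∧ en x' / 2 = en y / 2 ∧ en x' ≠ en y := by
            rcases hor with h | h
            · omega
            · exact h.2
          have hxl : lev x = D := by omega
          by_cases hpy : en y < j ∨ (en y = j ∧ q ≤ D)
          · refine (hne ?_).elim
            rw [tailColour_of_notMem hyA, tailColour_of_notMem hxA, hly, hxl, tailLabel_pos hpy,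
              tailLabel_pos (by omega), htop _ hyr.1 _ hxn]
          · rw [tailColour_of_notMem hyA, hly, tailLabel_neg hpy]
            congr 3
            split_ifs with hq <;> omega
        · refine ⟨Sum.inr (D, tailLabel b c T j q D
            (if en x % 2 = 0 then en x + 1 else en x - 1)), ?_⟩
          rintro x' hx' y hy hxx' hne hx'A hyA hor
          obtain ⟨-, hl, hlab⟩ := tailColour_eq_of_notMem hxA hxx'
          have hxe := tailLabel_eq_of_neg hp hlab
          have hyr := hG.range y hy hyA
          obtain ⟨hly, hen, hen'⟩ : lev y = D ∧ en x' / 2 = en y / 2 ∧ en x' ≠ en y := by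
            rcases hor with h | h
            · omega
            · exact h.2
          rw [tailColour_of_notMem hyA, hly]
          congr 3
          split_ifs with hq <;> omega
    have down : ∃ K : Finset (V ⊕ (ℕ × (V ⊕ ℕ))), K.card ≤ 3 ∧ ∀ x' ∈ G.verts, ∀ y ∈ G.verts,
        tailColour A lev en b c T j q x' = tailColour A lev en b c T j q x → x' ∉ A →
        ((y ∉ A ∧ en x' = en y ∧ lev x' = lev y + 1) ∨ (y ∈ A ∧ lev x' = 1 ∧ y = b (en x'))) →
        tailColour A lev en b c T j q y ∈ K := by
      by_cases hp : en x < j ∨ (en x = j ∧ q ≤ lev x)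
      · set φ : V → V ⊕ (ℕ × (V ⊕ ℕ)) :=
          fun k => if lev x = 1 then Sum.inl k else Sum.inr (lev x - 1, Sum.inl k) with hφ
        refine ⟨(((Finset.range n).filter (fun i => c (T (lev x - 1 + 1)) (b i) =
          c (T (lev x)) (b (en x)))).image (fun i => c (T (lev x - 1)) (b i))).image φ ∪
          {Sum.inr (lev x - 1, Sum.inr j)}, ?_, ?_⟩
        · refine le_trans (Finset.card_union_le _ _) ?_
          rw [Finset.card_singleton]
          exact Nat.add_le_add_right (le_trans Finset.card_image_le (hsplit _ (by omega) _)) 1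
        · rintro x' hx' y hy hxx' hx'A hor
          obtain ⟨-, hl, hlab⟩ := tailColour_eq_of_notMem hxA hxx'
          obtain ⟨hp', hcc⟩ := tailLabel_eq_of_pos hp hlab
          have hx'n := (hG.range x' hx' hx'A).1
          have hmem : φ (c (T (lev x - 1)) (b (en x'))) ∈
              (((Finset.range n).filter (fun i => c (T (lev x - 1 + 1)) (b i) =
                c (T (lev x)) (b (en x)))).image (fun i => c (T (lev x - 1)) (b i))).image φ := by
            refine Finset.mem_image_of_mem _ (Finset.mem_image.2 ⟨en x', ?_, rfl⟩)
            rw [Finset.mem_filter, Finset.mem_range, Nat.sub_add_cancel hx1]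
            exact ⟨hx'n, hcc⟩
          rcases hor with ⟨hyA, hen, hly⟩ | ⟨hyA, hly, rfl⟩
          · have hyr := hG.range y hy hyA
            have hly' : lev y = lev x - 1 := by omega
            rw [tailColour_of_notMem hyA, hly', ← hen]
            by_cases hpy : en x' < j ∨ (en x' = j ∧ q ≤ lev x - 1)
            · refine Finset.mem_union_left _ ?_
              rw [tailLabel_pos hpy]
              rwa [hφ, show ∀ k, (fun k => if lev x = 1 then Sum.inl k else
                (Sum.inr (lev x - 1, Sum.inl k) : V ⊕ (ℕ × (V ⊕ ℕ)))) k =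
                Sum.inr (lev x - 1, Sum.inl k) from fun k => if_neg (by omega)] at hmem
            · refine Finset.mem_union_right _ ?_
              rw [tailLabel_neg hpy, show en x' = j by omega]
              exact Finset.mem_singleton_self _
          · refine Finset.mem_union_left _ ?_
            have hlx : lev x = 1 := by omega
            rw [tailColour_of_mem hyA]
            simpa only [hφ, hlx, if_true] using hmem
      · refine ⟨{if lev x = 1 then Sum.inl (c (T 0) (b (en x))) else
          Sum.inr (lev x - 1, tailLabel b c T j q (lev x - 1) (en x))}, by simp, ?_⟩
        rintro x' hx' y hy hxx' hx'A hor
        obtain ⟨-, hl, hlab⟩ := tailColour_eq_of_notMem hxA hxx'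
        have hxe := tailLabel_eq_of_neg hp hlab
        rw [Finset.mem_singleton]
        rcases hor with ⟨hyA, hen, hly⟩ | ⟨hyA, hly, rfl⟩
        · have hyr := hG.range y hy hyA
          rw [if_neg (by omega), tailColour_of_notMem hyA, ← hen, hxe,
            show lev y = lev x - 1 by omega]
        · rw [if_pos (by omega), tailColour_of_mem hyA, hxe]
    obtain ⟨k, hk⟩ := up
    obtain ⟨K, hK, hKm⟩ := down
    refine ⟨K ∪ {k}, ?_, ?_⟩
    · refine le_trans (Finset.card_union_le _ _) (le_trans ?_ (le_max_right _ _))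
      rw [Finset.card_singleton]
      omega
    · rintro x' hx' y hy hxx' hne hadj -
      have hx'A := (tailColour_eq_of_notMem hxA hxx').1
      by_cases hyA : y ∈ A
      · obtain ⟨h1, h2⟩ := hG.adj_core x' hx' hx'A y hyA hadj
        exact Finset.mem_union_left _ (hKm x' hx' y hy hxx' hx'A (Or.inr ⟨hyA, h1, h2⟩))
      · rcases hG.adj_tail x' hx' hx'A y hy hyA hadj with ⟨h1, h2 | h2⟩ | h
        · exact Finset.mem_union_right _ (Finset.mem_singleton.2
            (hk x' hx' y hy hxx' hne hx'A hyA (Or.inl ⟨h1, h2⟩)))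
        · exact Finset.mem_union_left _ (hKm x' hx' y hy hxx' hx'A (Or.inl ⟨hyA, h1, h2⟩))
        · exact Finset.mem_union_right _ (Finset.mem_singleton.2
            (hk x' hx' y hy hxx' hne hx'A hyA (Or.inr h)))

end Trigraph

namespace Trigraph

variable {V : Type u}

/-! ### Contracting the tails of a tailed trigraph along a sequence for the core -/

/-- A sequence of naturals with steps at least `-1` that reaches `1` can be reparametrised so as
to decrease by at most one in each step and to reach `1` after `N 0` steps. -/
theorem exists_schedule {N : ℕ → ℕ} {n L : ℕ} (hN : ∀ s, N s ≤ N (s + 1) + 1) (h0 : N 0 ≤ n)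
    (hL : N L ≤ 1) :
    ∃ f : ℕ → ℕ, f 0 = 0 ∧ Monotone f ∧ (∀ p, N (f p) ≤ N (f (p + 1)) + 1) ∧
      ∀ p, n ≤ p → N (f p) ≤ 1 := by
  have hex : ∀ p, ∃ s, N s ≤ max (n - p) 1 := fun p => ⟨L, hL.trans (le_max_right _ _)⟩
  have hmono : Monotone fun p => Nat.find (hex p) := by
    intro p p' hp
    exact Nat.find_mono fun s hs => hs.trans (by omega)
  refine ⟨fun p => Nat.find (hex p), ?_, hmono, ?_, ?_⟩
  · rw [Nat.find_eq_zero]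
    omega
  · intro p
    have hp : Nat.find (hex p) ≤ Nat.find (hex (p + 1)) := hmono (Nat.le_succ p)
    have h1 := Nat.find_spec (hex p)
    simp only
    rcases Nat.eq_zero_or_pos (Nat.find (hex (p + 1))) with h | h
    · rw [h] at hp ⊢
      rw [Nat.le_zero.1 hp]
      omega
    · have h2 := Nat.find_min (hex (p + 1)) (Nat.sub_lt h Nat.one_pos)
      have h3 := hN (Nat.find (hex (p + 1)) - 1)
      rw [Nat.sub_add_cancel h] at h3
      omega
  · intro p hp
    have h1 := Nat.find_spec (hex p)
    simp only
    omega

/-- If `h` identifies at most one pair of elements of `I`, then its fibres have at most two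
elements. -/
theorem card_fibre_le_two {α β : Type*} {I : Finset α} {h : α → β}
    (hI : I.card ≤ (I.image h).card + 1) (γ : β) : (I.filter (fun x => h x = γ)).card ≤ 2 := by
  have h1 : (I.image h).card ≤ (I.filter (fun x => ¬ h x = γ)).card + 1 := by
    refine le_trans (Finset.card_le_card (t := (I.filter (fun x => ¬ h x = γ)).image h ∪ {γ}) ?_) ?_
    · intro k hk
      obtain ⟨x, hx, rfl⟩ := Finset.mem_image.1 hk
      by_cases hxγ : h x = γ
      · exact Finset.mem_union_right _ (Finset.mem_singleton.2 hxγ)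
      · exact Finset.mem_union_left _ (Finset.mem_image_of_mem _ (Finset.mem_filter.2 ⟨hx, hxγ⟩))
    · refine (Finset.card_union_le _ _).trans ?_
      rw [Finset.card_singleton]
      exact Nat.add_le_add_right Finset.card_image_le 1
  have h2 := Finset.card_filter_add_card_filter_not (s := I) (fun x => h x = γ)
  omega

/-- The colourings `c 0, c 1, …` successively identify colours, one pair at a time. -/
def Merging (c : ℕ → V → V) : Prop :=
  ∀ s, ∃ a a', ∀ x, c (s + 1) x = if c s x = a then a' else c s x

theorem Merging.exists_factor {c : ℕ → V → V} (hc : Merging c) {s s' : ℕ} (h : s ≤ s') :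
    ∃ g : V → V, ∀ x, c s' x = g (c s x) := by
  induction s', h using Nat.le_induction with
  | base => exact ⟨id, fun _ => rfl⟩
  | succ s' _ ih =>
    obtain ⟨g, hg⟩ := ih
    obtain ⟨a, a', ha⟩ := hc s'
    exact ⟨fun k => if g k = a then a' else g k, fun x => by rw [ha, hg]⟩

/-- The number of colours of `c s` on the vertices `b 0, …, b (n - 1)`. -/
noncomputable def numColours (c : ℕ → V → V) (b : ℕ → V) (n s : ℕ) : ℕ :=
  ((Finset.range n).image (fun i => c s (b i))).card

theorem Merging.numColours_antitone {c : ℕ → V → V} (hc : Merging c) (b : ℕ → V) (n : ℕ) :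
    Antitone (numColours c b n) := by
  intro s s' h
  obtain ⟨g, hg⟩ := hc.exists_factor h
  refine card_image_le_of_ker fun x _ y _ e => ?_
  rw [hg, hg, e]

theorem Merging.numColours_le_succ {c : ℕ → V → V} (hc : Merging c) (b : ℕ → V) (n s : ℕ) :
    numColours c b n s ≤ numColours c b n (s + 1) + 1 := by
  obtain ⟨a, a', ha⟩ := hc s
  refine le_trans (Finset.card_le_card (t := (Finset.range n).image (fun i => c (s + 1) (b i)) ∪ {a})
    ?_) ((Finset.card_union_le _ _).trans (by rw [Finset.card_singleton]; rfl))
  intro k hk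
  obtain ⟨i, hi, rfl⟩ := Finset.mem_image.1 hk
  by_cases h : c s (b i) = a
  · exact Finset.mem_union_right _ (Finset.mem_singleton.2 h)
  · refine Finset.mem_union_left _ (Finset.mem_image.2 ⟨i, hi, ?_⟩)
    simp only [ha]
    rw [if_neg h]

theorem Merging.card_split_le {c : ℕ → V → V} (hc : Merging c) {b : ℕ → V} {n s s' : ℕ}
    (h : s ≤ s') (hN : numColours c b n s ≤ numColours c b n s' + 1) (γ : V) :
    (((Finset.range n).filter (fun i => c s' (b i) = γ)).image (fun i => c s (b i))).card ≤ 2 := by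
  obtain ⟨g, hg⟩ := hc.exists_factor h
  have himg : ((Finset.range n).image (fun i => c s (b i))).image g =
      (Finset.range n).image (fun i => c s' (b i)) := by
    rw [Finset.image_image]
    exact Finset.image_congr fun i _ => (hg _).symm
  refine le_trans (Finset.card_le_card ?_)
    (card_fibre_le_two (I := (Finset.range n).image (fun i => c s (b i))) (h := g) ?_ γ)
  · intro k hk
    obtain ⟨i, hi, rfl⟩ := Finset.mem_image.1 hk
    obtain ⟨hi, hγ⟩ := Finset.mem_filter.1 hi
    exact Finset.mem_filter.2 ⟨Finset.mem_image_of_mem _ hi, by rw [← hg, hγ]⟩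
  · rw [himg]
    exact hN

section

variable {G : Trigraph V} {A : Finset V} {n D : ℕ} {lev en : V → ℕ} {b : ℕ → V}
  {c : ℕ → V → V} {t : ℕ}

theorem IsTailed.qWidth_of_numColours (hG : IsTailed G A n D lev en b) (hm : Merging c)
    (hc0 : Set.InjOn (c 0) A) (hw : ∀ s, QWidth G A (c s) t) {T : ℕ → ℕ} {j q : ℕ}
    (hT : ∀ p < D, T p ≤ T (p + 1))
    (hN : ∀ p < D, numColours c b n (T p) ≤ numColours c b n (T (p + 1)) + 1)
    (hD : numColours c b n (T D) ≤ 1) (hproc : T 0 = 0 ∨ n ≤ j) :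
    QWidth G G.verts (tailColour A lev en b c T j q) (max (t + 1) 4) := by
  refine hG.qWidth_tailColour hc0 (hw _) ?_ ?_ ?_ hproc
  · intro i hi i' hi'
    exact Finset.card_le_one.1 hD _ (Finset.mem_image.2 ⟨i, Finset.mem_range.2 hi, rfl⟩) _
      (Finset.mem_image.2 ⟨i', Finset.mem_range.2 hi', rfl⟩)
  · intro p hp i _ i' _ e
    obtain ⟨g, hg⟩ := hm.exists_factor (hT p hp)
    rw [hg, hg, e]
  · intro p hp γ
    exact hm.card_split_le (hT p hp) (hN p hp) γ

theorem tailColour_congr {T T' : ℕ → ℕ} {j j' q q' : ℕ} (hG : IsTailed G A n D lev en b)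
    (h0 : T 0 = T' 0)
    (h : ∀ p, 1 ≤ p → p ≤ D → ∀ i < n,
      tailLabel b c T j q p i = tailLabel b c T' j' q' p i) :
    ∀ x ∈ G.verts, tailColour A lev en b c T j q x = tailColour A lev en b c T' j' q' x := by
  intro x hx
  by_cases hxA : x ∈ A
  · rw [tailColour_of_mem hxA, tailColour_of_mem hxA, h0]
  · obtain ⟨h1, h2, h3⟩ := hG.range x hx hxA
    rw [tailColour_of_notMem hxA, tailColour_of_notMem hxA, h _ h2 h3 _ h1]

/-- All tails are identified level by level according to the schedule `f`. -/
theorem IsTailed.recolourSeq_zip (hG : IsTailed G A n D lev en b) (hm : Merging c)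
    (hc0 : Set.InjOn (c 0) A) (hw : ∀ s, QWidth G A (c s) t) {f : ℕ → ℕ} (hf0 : f 0 = 0)
    (hf : Monotone f) (hN : ∀ p, numColours c b n (f p) ≤ numColours c b n (f (p + 1)) + 1)
    (hD : numColours c b n (f D) ≤ 1) (j : ℕ) :
    RecolourSeq G (max (t + 1) 4) (tailColour A lev en b c f 0 (D + 1))
      (tailColour A lev en b c f j (D + 1)) := by
  have hwid : ∀ j q, QWidth G G.verts (tailColour A lev en b c f j q) (max (t + 1) 4) :=
    fun j q => hG.qWidth_of_numColours hm hc0 hw (fun p _ => hf (Nat.le_succ p))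
      (fun p _ => hN p) hD (Or.inl hf0)
  induction j with
  | zero => exact Relation.ReflTransGen.refl
  | succ j ih =>
    have hstep : ∀ r ≤ D, RecolourSeq G (max (t + 1) 4) (tailColour A lev en b c f j (D + 1))
        (tailColour A lev en b c f j (D + 1 - r)) := by
      intro r
      induction r with
      | zero => exact fun _ => Relation.ReflTransGen.refl
      | succ r ih =>
        intro hr
        refine (ih (by omega)).tail ⟨?_, hwid _ _⟩
        obtain ⟨q, hq, hq'⟩ : ∃ q, D + 1 - (r + 1) = q ∧ D + 1 - r = q + 1 :=
          ⟨_, rfl, by omega⟩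
        rw [hq, hq']
        refine ⟨Sum.inr (q, Sum.inr j), Sum.inr (q, Sum.inl (c (f q) (b j))), fun x _ => ?_⟩
        by_cases hxA : x ∈ A
        · rw [tailColour_of_mem hxA, tailColour_of_mem hxA, if_neg Sum.inl_ne_inr]
        · rw [tailColour_of_notMem hxA, tailColour_of_notMem hxA]
          by_cases hx : lev x = q ∧ en x = j
          · obtain ⟨h1, h2⟩ := hx
            rw [h1, h2, tailLabel_pos (by omega), tailLabel_neg (by omega), if_pos rfl]
          · by_cases hp : en x < j ∨ (en x = j ∧ q ≤ lev x)
            · rw [tailLabel_pos hp, tailLabel_pos (by omega), if_neg]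
              intro e
              have := (Prod.mk.inj (Sum.inr_injective e)).2
              exact Sum.inl_ne_inr this
            · rw [tailLabel_neg hp, tailLabel_neg (by omega), if_neg]
              intro e
              have := Prod.mk.inj (Sum.inr_injective e)
              exact hx ⟨this.1, Sum.inr_injective this.2⟩
    refine (ih.trans (hstep D le_rfl)).tail ⟨?_, hwid _ _⟩
    refine Recolours.of_eqOn (tailColour_congr hG rfl ?_) (Sum.inr (0, Sum.inr 0))
    intro p hp hpD i _
    by_cases hij : i < j + 1
    · rw [tailLabel_pos (by omega), tailLabel_pos (by omega)]
    · rw [tailLabel_neg (by omega), tailLabel_neg (by omega)]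

/-- Once the tails are identified according to the schedule `f`, the core can be contracted. -/
theorem IsTailed.recolourSeq_core (hG : IsTailed G A n D lev en b) (hm : Merging c)
    (hc0 : Set.InjOn (c 0) A) (hw : ∀ s, QWidth G A (c s) t) {f : ℕ → ℕ} (hf0 : f 0 = 0)
    (hf : Monotone f) (hN : ∀ p, numColours c b n (f p) ≤ numColours c b n (f (p + 1)) + 1)
    (hD : numColours c b n (f D) ≤ 1) (s : ℕ) :
    RecolourSeq G (max (t + 1) 4) (tailColour A lev en b c f n (D + 1))
      (tailColour A lev en b c (fun p => max (f p) s) n (D + 1)) := by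
  have hanti := hm.numColours_antitone b n
  have hwid : ∀ s q, QWidth G G.verts (tailColour A lev en b c
      (fun p => max (f p) (if q ≤ p then s + 1 else s)) n (D + 1)) (max (t + 1) 4) := by
    intro s q
    refine hG.qWidth_of_numColours hm hc0 hw ?_ ?_ ?_ (Or.inr le_rfl)
    · intro p _
      have := hf (Nat.le_succ p)
      simp only [Nat.succ_eq_add_one] at this ⊢
      split_ifs <;> omega
    · intro p _
      simp only [hanti.map_max]
      have h1 := hN p
      have h2 := hm.numColours_le_succ b n s
      split_ifs <;> omega
    · exact (hanti (le_max_left _ _)).trans hD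
  have hwid' : ∀ s, QWidth G G.verts (tailColour A lev en b c
      (fun p => max (f p) s) n (D + 1)) (max (t + 1) 4) := by
    intro s
    refine hG.qWidth_of_numColours hm hc0 hw ?_ ?_ ?_ (Or.inr le_rfl)
    · intro p _
      have := hf (Nat.le_succ p)
      simp only [Nat.succ_eq_add_one] at this ⊢
      omega
    · intro p _
      simp only [hanti.map_max]
      have h1 := hN p
      omega
    · exact (hanti (le_max_left _ _)).trans hD
  induction s with
  | zero =>
    simp only [Nat.max_zero]
    exact Relation.ReflTransGen.refl
  | succ s ih =>
    have hstep : ∀ r ≤ D + 1, RecolourSeq G (max (t + 1) 4)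
        (tailColour A lev en b c (fun p => max (f p) s) n (D + 1))
        (tailColour A lev en b c
          (fun p => max (f p) (if D + 1 - r ≤ p then s + 1 else s)) n (D + 1)) := by
      intro r
      induction r with
      | zero =>
        intro _
        refine Relation.ReflTransGen.single ⟨?_, hwid _ _⟩
        refine Recolours.of_eqOn (tailColour_congr hG ?_ ?_) (Sum.inr (0, Sum.inr 0))
        · simp
        · intro p _ hpD i hi
          rw [tailLabel_pos (by omega), tailLabel_pos (by omega), if_neg (by omega)]
      | succ r ih =>
        intro hr
        refine (ih (by omega)).tail ⟨?_, hwid _ _⟩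
        obtain ⟨q, hq, hq'⟩ : ∃ q, D + 1 - (r + 1) = q ∧ D + 1 - r = q + 1 :=
          ⟨_, rfl, by omega⟩
        rw [hq, hq']
        by_cases hfq : f q ≤ s
        · obtain ⟨a, a', ha⟩ := hm s
          refine ⟨if q = 0 then Sum.inl a else Sum.inr (q, Sum.inl a),
            if q = 0 then Sum.inl a' else Sum.inr (q, Sum.inl a'), fun x hx => ?_⟩
          by_cases hxA : x ∈ A
          · rw [tailColour_of_mem hxA, tailColour_of_mem hxA]
            by_cases hq0 : q = 0
            · subst hq0
              simp only [le_refl, if_true, hf0, Nat.zero_max]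
              rw [ha]
              by_cases hca : c s x = a
              · simp [hca]
              · simp [hca]
            · simp [hq0]
          · obtain ⟨h1, h2, h3⟩ := hG.range x hx hxA
            rw [tailColour_of_notMem hxA, tailColour_of_notMem hxA, tailLabel_pos (by omega),
              tailLabel_pos (by omega)]
            by_cases hlq : lev x = q
            · have hq0 : q ≠ 0 := by omega
              have hqs : ¬ q + 1 ≤ q := by omega
              simp only [hlq, le_refl, if_true, hqs, if_false, hq0, max_eq_right hfq,
                max_eq_right (hfq.trans (Nat.le_succ s)), ha]
              by_cases hca : c s (b (en x)) = a
              · simp [hca]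
              · simp [hca]
            · have e : (q ≤ lev x) ↔ (q + 1 ≤ lev x) := by omega
              simp only [e]
              refine (if_neg fun h => ?_).symm
              by_cases hq0 : q = 0
              · rw [if_pos hq0] at h
                exact Sum.inr_ne_inl h
              · rw [if_neg hq0] at h
                exact hlq (Prod.mk.inj (Sum.inr_injective h)).1
        · refine Recolours.of_eqOn (tailColour_congr hG ?_ ?_) (Sum.inr (0, Sum.inr 0))
          · have hq0 : q ≠ 0 := by
              rintro rfl
              omega
            simp [hq0]
          · intro p _ hpD i hi
            rw [tailLabel_pos (by omega), tailLabel_pos (by omega)]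
            by_cases hpq : p = q
            · subst hpq
              rw [if_pos le_rfl, if_neg (by omega), max_eq_left (by omega),
                max_eq_left (by omega)]
            · have e : (q ≤ p) ↔ (q + 1 ≤ p) := by omega
              simp only [e]
    refine (ih.trans (hstep (D + 1) le_rfl)).tail ⟨?_, hwid' _⟩
    refine Recolours.of_eqOn (tailColour_congr hG ?_ ?_) (Sum.inr (0, Sum.inr 0))
    · simp
    · intro p _ hpD i hi
      rw [tailLabel_pos (by omega), tailLabel_pos (by omega)]
      simp

/-- A tailed trigraph whose core is a single class and whose tails are fully identified is
contracted from the root upwards. -/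
theorem IsTailed.recolourSeq_path {C : Type*} (hG : IsTailed G A n D lev en b) {κ : ℕ → C}
    (hκ : Function.Injective κ) {w : ℕ} (hw : 2 ≤ w) (r : ℕ) :
    RecolourSeq G w (fun v => κ (if v ∈ A then 0 else lev v))
      (fun v => κ (max (if v ∈ A then 0 else lev v) r)) := by
  have hwid : ∀ r, QWidth G G.verts (fun v => κ (max (if v ∈ A then 0 else lev v) r)) w := by
    intro r
    refine QWidth.mono ?_ hw
    apply qWidth_of_neighbours
    intro x hx
    refine ⟨{κ (max (if x ∈ A then 0 else lev x) r - 1)} ∪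
      {κ (max (if x ∈ A then 0 else lev x) r + 1)}, card_insert_singleton_le_two _ _, ?_⟩
    rintro x' hx' y hy hxx' hne hadj -
    have hxx' := hκ hxx'
    rw [Finset.mem_union, Finset.mem_singleton, Finset.mem_singleton, hκ.eq_iff, hκ.eq_iff]
    rw [Ne, hκ.eq_iff] at hne
    by_cases hyA : y ∈ A
    · by_cases hxA : x' ∈ A
      · rw [if_pos hxA] at hxx'
        rw [if_pos hyA] at hne
        exact (hne hxx').elim
      · obtain ⟨h1, -⟩ := hG.adj_core x' hx' hxA y hyA hadj
        rw [if_neg hxA] at hxx'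
        rw [if_pos hyA] at hne ⊢
        omega
    · by_cases hxA : x' ∈ A
      · obtain ⟨h1, -⟩ := hG.adj_core y hy hyA x' hxA (adj_comm.1 hadj)
        rw [if_pos hxA] at hxx'
        rw [if_neg hyA] at hne ⊢
        omega
      · have := hG.adj_tail x' hx' hxA y hy hyA hadj
        rw [if_neg hxA] at hxx'
        rw [if_neg hyA] at hne ⊢
        omega
  induction r with
  | zero =>
    simp only [Nat.max_zero]
    exact Relation.ReflTransGen.refl
  | succ r ih =>
    refine ih.tail ⟨⟨κ r, κ (r + 1), fun x _ => ?_⟩, hwid _⟩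
    simp only [hκ.eq_iff]
    generalize (if x ∈ A then 0 else lev x) = l
    split_ifs with h
    · congr 1
      omega
    · congr 1
      omega

/-- Attaching tails of length at least their number to a core increases the width of a contraction
sequence by at most one, up to the threshold `4`. -/
theorem IsTailed.tww_le (hG : IsTailed G A n D lev en b) (hne : G.verts.Nonempty) (hnD : n ≤ D)
    (hm : Merging c) (hc0 : Set.InjOn (c 0) A) (hw : ∀ s, QWidth G A (c s) t) {L : ℕ}
    (hL : ∀ x ∈ A, ∀ y ∈ A, c L x = c L y) : G.tww ≤ max (t + 1) 4 := by
  obtain ⟨a₀, ha₀⟩ : A.Nonempty := by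
    obtain ⟨x, hx⟩ := hne
    by_contra hA
    rw [Finset.not_nonempty_iff_eq_empty] at hA
    have h1 := (hG.range x hx (by simp [hA])).1
    have h2 := hG.root_mem _ h1
    simp [hA] at h2
  obtain ⟨f, hf0, hf, hN, hf1⟩ := exists_schedule (N := numColours c b n) (n := n) (L := L)
    (hm.numColours_le_succ b n) (Finset.card_image_le.trans (Finset.card_range n).le) (by
      refine Finset.card_le_one.2 fun k hk l hl => ?_
      obtain ⟨i, hi, rfl⟩ := Finset.mem_image.1 hk
      obtain ⟨i', hi', rfl⟩ := Finset.mem_image.1 hl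
      exact hL _ (hG.root_mem i (Finset.mem_range.1 hi)) _
        (hG.root_mem i' (Finset.mem_range.1 hi')))
  have hD := hf1 D hnD
  have hzip := hG.recolourSeq_zip hm hc0 hw hf0 hf hN hD n
  have hcore := hG.recolourSeq_core hm hc0 hw hf0 hf hN hD L
  set κ : ℕ → V ⊕ (ℕ × (V ⊕ ℕ)) := fun p =>
    if p = 0 then Sum.inl (c (max (f 0) L) a₀) else Sum.inr (p, Sum.inl (c (max (f p) L) a₀))
    with hκdef
  have hκ : Function.Injective κ := by
    intro p p' h
    simp only [hκdef] at h
    split_ifs at h with h1 h2 h2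
    · omega
    · exact (Prod.mk.inj (Sum.inr_injective h)).1
  have hconst : ∀ s, L ≤ s → ∀ x ∈ A, c s x = c s a₀ := by
    intro s hs x hx
    obtain ⟨g, hg⟩ := hm.exists_factor hs
    rw [hg, hg, hL x hx a₀ ha₀]
  have hpath := hG.recolourSeq_path hκ (w := max (t + 1) 4) (by omega)
  have hmid : RecolourStep G (max (t + 1) 4)
      (tailColour A lev en b c (fun p => max (f p) L) n (D + 1))
      (fun v => κ (if v ∈ A then 0 else lev v)) := by
    have heq : ∀ x ∈ G.verts, κ (if x ∈ A then 0 else lev x) =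
        tailColour A lev en b c (fun p => max (f p) L) n (D + 1) x := by
      intro x hx
      by_cases hxA : x ∈ A
      · rw [if_pos hxA, tailColour_of_mem hxA, hconst _ (le_max_right _ _) x hxA]
        rfl
      · obtain ⟨h1, h2, h3⟩ := hG.range x hx hxA
        rw [if_neg hxA, tailColour_of_notMem hxA, tailLabel_pos (by omega),
          hconst _ (le_max_right _ _) _ (hG.root_mem _ h1)]
        exact if_neg (by omega)
    refine ⟨Recolours.of_eqOn heq (Sum.inr (0, Sum.inr 0)), ?_⟩
    have hq := hG.qWidth_of_numColours hm hc0 hw (T := fun p => max (f p) L) (j := n) (q := D + 1)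
      (fun p _ => max_le_max_right _ (hf (Nat.le_succ p))) (fun p _ => by
        simp only [(hm.numColours_antitone b n).map_max]
        have h1 := hN p
        omega) (((hm.numColours_antitone b n) (le_max_left _ _)).trans hD) (Or.inr le_rfl)
    refine hq.of_sameKer fun x hx y hy => ?_
    rw [heq x hx, heq y hy]
  refine tww_le_of_recolourSeq hne (c := tailColour A lev en b c f 0 (D + 1)) ?_ ?_
    (((hzip.trans hcore).tail hmid).trans (hpath D)) ?_
  · intro x hx y hy e
    have hx : x ∈ G.verts := hx
    have hy : y ∈ G.verts := hy
    by_cases hyA : y ∈ A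
    · obtain ⟨hxA, h⟩ := tailColour_eq_of_mem hyA e
      rw [hf0] at h
      exact hc0 hxA hyA h
    · obtain ⟨hxA, h1, h2⟩ := tailColour_eq_of_notMem hyA e
      have hyr := hG.range y hy hyA
      exact hG.inj x hx hxA y hy hyA (tailLabel_eq_of_neg (by omega) h2) h1
  · exact hG.qWidth_of_numColours hm hc0 hw (fun p _ => hf (Nat.le_succ p))
      (fun p _ => hN p) hD (Or.inl hf0)
  · intro x hx y hy
    have hle : ∀ z ∈ G.verts, max (if z ∈ A then 0 else lev z) D = D := by
      intro z hz
      split_ifs with hzA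
      · omega
      · have := hG.range z hz hzA
        omega
    rw [hle x hx, hle y hy]

end

end Trigraph

namespace Trigraph

variable {V : Type u} {G : Trigraph V} {HV : Finset V} {P : Finset (List V)} {p q : List V}
  {i j : ℕ} {x y : V}

theorem exists_getElem?_of_infix (h : [x, y] <:+: p) :
    ∃ i, p[i]? = some x ∧ p[i + 1]? = some y := by
  obtain ⟨s, t, rfl⟩ := h
  refine ⟨s.length, ?_, ?_⟩ <;> simp

theorem getElem?_inj_of_nodup (hp : p.Nodup) (hi : p[i]? = some x) (hj : p[j]? = some x) :
    i = j :=
  (List.getElem?_inj (List.getElem?_eq_some_iff.1 hi).1 hp).1 (hi.trans hj.symm)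

/-- Vertices of the same path of a tidy trigraph are only adjacent if they are consecutive. -/
theorem IsTidy.index_of_adj (ht : IsTidy G HV P) (hp : p ∈ P) (hi : p[i]? = some x)
    (hj : p[j]? = some y) (h : G.Adj x y) : j = i + 1 ∨ i = j + 1 := by
  have hnd := (ht.paths p hp).2.1
  rcases ht.pathsInduced p hp x (List.mem_of_getElem? hi) y (List.mem_of_getElem? hj) h with h | h
  · obtain ⟨r, h1, h2⟩ := exists_getElem?_of_infix h
    have := getElem?_inj_of_nodup hnd hi h1
    have := getElem?_inj_of_nodup hnd hj h2
    omega
  · obtain ⟨r, h1, h2⟩ := exists_getElem?_of_infix h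
    have := getElem?_inj_of_nodup hnd hj h1
    have := getElem?_inj_of_nodup hnd hi h2
    omega

theorem IsTidy.adj_succ (ht : IsTidy G HV P) (hp : p ∈ P) (hi : p[i]? = some x)
    (hj : p[i + 1]? = some y) : G.Adj x y := by
  obtain ⟨h1, rfl⟩ := List.getElem?_eq_some_iff.1 hi
  obtain ⟨h2, rfl⟩ := List.getElem?_eq_some_iff.1 hj
  exact Or.inr (List.isChain_iff_getElem.1 (ht.paths p hp).2.2.1 i h2)

theorem IsTidy.mem_of_adj (ht : IsTidy G HV P) (hp : p ∈ P) (hx : x ∈ p) (h : G.Adj x y) :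
    y ∈ p ∨ y ∈ HV := by
  rcases ht.cover y h.mem_right with hy | ⟨q, hq, hy⟩
  · exact Or.inr hy
  · by_cases e : p = q
    · exact Or.inl (e ▸ hy)
    · exact (ht.noPathPathEdges p hp q hq e x hx y hy h).elim

theorem eq_or_eq_of_deg_eq_two (hx : G.deg x = 2) {u v w : V} (huv : u ≠ v) (hu : G.Adj x u)
    (hv : G.Adj x v) (hw : G.Adj x w) : w = u ∨ w = v := by
  by_contra hne
  rw [not_or] at hne
  have h3 : ({w, u, v} : Finset V) ⊆ G.verts.filter (fun y => G.Adj x y) := by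
    intro y hy
    simp only [Finset.mem_insert, Finset.mem_singleton] at hy
    rcases hy with rfl | rfl | rfl
    · exact Finset.mem_filter.2 ⟨hw.mem_right, hw⟩
    · exact Finset.mem_filter.2 ⟨hu.mem_right, hu⟩
    · exact Finset.mem_filter.2 ⟨hv.mem_right, hv⟩
  have h4 := Finset.card_le_card h3
  rw [← deg_eq, hx, Finset.card_eq_three.2 ⟨w, u, v, hne.1, hne.2, huv, rfl⟩] at h4
  omega

/-- Only the end vertices of a path have a neighbour in `H`. -/
theorem IsTidy.end_of_adj (ht : IsTidy G HV P) (hp : p ∈ P) (hi : p[i]? = some x)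
    (hy : y ∈ HV) (h : G.Adj x y) : i = 0 ∨ i + 1 = p.length := by
  by_contra hne
  have hil := (List.getElem?_eq_some_iff.1 hi).1
  obtain ⟨r, rfl⟩ : ∃ r, i = r + 1 := ⟨i - 1, by omega⟩
  have h1 : p[r]? = some p[r] := List.getElem?_eq_getElem (by omega)
  have h2 : p[r + 1 + 1]? = some p[r + 1 + 1] := List.getElem?_eq_getElem (by omega)
  have hne' : p[r] ≠ p[r + 1 + 1] := by
    intro e
    rw [e] at h1
    have := getElem?_inj_of_nodup (ht.paths p hp).2.1 h1 h2
    omega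
  rcases eq_or_eq_of_deg_eq_two ((ht.paths p hp).2.2.2 x (List.mem_of_getElem? hi)).2 hne'
    (adj_comm.1 (ht.adj_succ hp h1 hi)) (ht.adj_succ hp hi h2) h with rfl | rfl
  · exact ht.Hdisj p hp _ (List.mem_of_getElem? h1) hy
  · exact ht.Hdisj p hp _ (List.mem_of_getElem? h2) hy

/-- An end vertex of a path has exactly one neighbour in `H`. -/
theorem IsTidy.exists_root (ht : IsTidy G HV P) (hp : p ∈ P) (hlen : 2 ≤ p.length)
    (hend : i = 0 ∨ i + 1 = p.length) (hi : p[i]? = some x) :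
    ∃ w ∈ HV, G.Adj x w ∧ ∀ y ∈ HV, G.Adj x y → y = w := by
  obtain ⟨z, hz, hxz, huniq⟩ : ∃ z ∈ p, G.Adj x z ∧ ∀ y ∈ p, G.Adj x y → y = z := by
    obtain ⟨j, hj, hij⟩ : ∃ j < p.length, j = i + 1 ∨ i = j + 1 := by
      by_cases h0 : i = 0
      · exact ⟨1, by omega, by omega⟩
      · exact ⟨i - 1, by omega, by omega⟩
    have hj' : p[j]? = some p[j] := List.getElem?_eq_getElem hj
    refine ⟨p[j], List.getElem_mem hj, ?_, fun y hy hxy => ?_⟩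
    · rcases hij with rfl | rfl
      · exact ht.adj_succ hp hi hj'
      · exact adj_comm.1 (ht.adj_succ hp hj' hi)
    · obtain ⟨r, hr⟩ := List.mem_iff_getElem?.1 hy
      have h1 := ht.index_of_adj hp hi hr hxy
      have h2 := (List.getElem?_eq_some_iff.1 hr).1
      obtain rfl : r = j := by omega
      exact Option.some_injective _ (hr.symm.trans hj')
  have hdeg := ((ht.paths p hp).2.2.2 x (List.mem_of_getElem? hi)).2
  obtain ⟨w, hw, hwz⟩ := Finset.exists_mem_ne (s := G.verts.filter (fun y => G.Adj x y))
    (by rw [← deg_eq, hdeg]; omega) z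
  have hxw := (Finset.mem_filter.1 hw).2
  have hwH : w ∈ HV :=
    (ht.mem_of_adj hp (List.mem_of_getElem? hi) hxw).resolve_left fun h => hwz (huniq w h hxw)
  refine ⟨w, hwH, hxw, fun y hy hxy => ?_⟩
  refine (eq_or_eq_of_deg_eq_two hdeg hwz hxw hxz hxy).resolve_right ?_
  rintro rfl
  exact ht.Hdisj p hp _ hz hy

theorem mem_shortPath {m : ℕ} : x ∈ shortPath m p ↔
    ∃ j, p[j]? = some x ∧ (8 * m < p.length → j < 4 * m ∨ p.length ≤ j + 4 * m) := by
  unfold shortPath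
  split_ifs with h
  · rw [List.mem_append]
    simp only [List.mem_iff_getElem?, List.getElem?_take, List.getElem?_drop]
    constructor
    · rintro (⟨j, hj⟩ | ⟨j, hj⟩)
      · split_ifs at hj with hjm
        exact ⟨j, hj, fun _ => Or.inl hjm⟩
      · exact ⟨_, hj, fun _ => Or.inr (by omega)⟩
    · rintro ⟨j, hj, hjm⟩
      rcases hjm h with hjm | hjm
      · exact Or.inl ⟨j, by rw [if_pos hjm, hj]⟩
      · exact Or.inr ⟨j + 4 * m - p.length, by rw [← hj]; congr 1; omega⟩
  · simp [List.mem_iff_getElem?, h]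

/-- `v` is the `l`-th vertex, counted from an end, of the half path number `i`: the half paths
`2 * a` and `2 * a + 1` start at the two ends of the `a`-th path of `L`. -/
def IsTailVertex (L : List (List V)) (i l : ℕ) (v : V) : Prop :=
  ∃ p j, L[i / 2]? = some p ∧ p[j]? = some v ∧
    (i % 2 = 0 ∧ j + 1 = l ∨ i % 2 = 1 ∧ j + l = p.length)

theorem adj_or_join_of_shorten_adj [Inhabited V] (h : (G.shorten HV P).Adj x y) :
    G.Adj x y ∨ s(x, y) ∈ joinEdges P := by
  rcases h with h | h
  · exact Or.inl (Or.inl (Finset.mem_filter.1 h).1)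
  · rcases Finset.mem_union.1 h with h | h
    · exact Or.inl (Or.inr (Finset.mem_filter.1 h).1)
    · exact Or.inr (Finset.mem_filter.1 h).1

/-- The vertices of the shortened trigraph that are not on a shortened path. -/
noncomputable def shortenCore [Inhabited V] (G : Trigraph V) (HV : Finset V)
    (P : Finset (List V)) : Finset V :=
  (G.shorten HV P).verts.filter (fun v => ∀ p ∈ P, 8 * P.card < p.length → v ∉ p)

theorem mem_of_mem_joinEdges [Inhabited V] (hP : 0 < P.card) (h : s(x, y) ∈ joinEdges P) :
    ∃ p ∈ P, 8 * P.card < p.length ∧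
      (p[4 * P.card - 1]? = some x ∧ p[p.length - 4 * P.card]? = some y ∨
        p[4 * P.card - 1]? = some y ∧ p[p.length - 4 * P.card]? = some x) := by
  obtain ⟨p, hp, he⟩ := Finset.mem_image.1 h
  obtain ⟨hp, hlen⟩ := Finset.mem_filter.1 hp
  have h1 : p[4 * P.card - 1]? = some (p.getD (4 * P.card - 1) default) := by
    rw [List.getD_eq_getElem _ _ (by omega)]
    exact List.getElem?_eq_getElem _
  have h2 : p[p.length - 4 * P.card]? = some (p.getD (p.length - 4 * P.card) default) := by
    rw [List.getD_eq_getElem _ _ (by omega)]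
    exact List.getElem?_eq_getElem _
  refine ⟨p, hp, hlen, ?_⟩
  rcases Sym2.eq_iff.1 he with ⟨rfl, rfl⟩ | ⟨rfl, rfl⟩
  · exact Or.inl ⟨h1, h2⟩
  · exact Or.inr ⟨h1, h2⟩

theorem adj_of_shorten_adj_of_mem_core [Inhabited V] (hP : 0 < P.card)
    (hy : y ∈ shortenCore G HV P) (h : (G.shorten HV P).Adj x y) : G.Adj x y := by
  refine (adj_or_join_of_shorten_adj h).resolve_right fun hj => ?_
  obtain ⟨p, hp, hlen, h1⟩ := mem_of_mem_joinEdges hP hj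
  refine (Finset.mem_filter.1 hy).2 p hp hlen ?_
  rcases h1 with ⟨-, h1⟩ | ⟨h1, -⟩
  · exact List.mem_of_getElem? h1
  · exact List.mem_of_getElem? h1

/-- The shortened trigraph is its core together with the halves of the shortened paths. -/
theorem IsTidy.exists_isTailed [Inhabited V] (ht : IsTidy G HV P) :
    ∃ n lev en b, n ≤ 4 * P.card ∧
      IsTailed (G.shorten HV P) (shortenCore G HV P) n (4 * P.card) lev en b := by
  have hm : 0 < P.card := Finset.card_pos.2 ht.Pne
  obtain ⟨L, hLnd, hLmem, hLcard⟩ : ∃ L : List (List V), L.Nodup ∧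
      (∀ p, p ∈ L ↔ p ∈ P ∧ 8 * P.card < p.length) ∧ L.length ≤ P.card := by
    refine ⟨(P.filter (fun p => 8 * P.card < p.length)).toList, Finset.nodup_toList _,
      fun p => by simp, ?_⟩
    rw [Finset.length_toList]
    exact Finset.card_filter_le _ _
  have hL : ∀ {i : ℕ} {p}, L[i]? = some p → p ∈ P ∧ 8 * P.card < p.length := fun h =>
    (hLmem _).1 (List.mem_of_getElem? h)
  have hunique : ∀ {i i' : ℕ} {p p' v}, L[i]? = some p → L[i']? = some p' → v ∈ p → v ∈ p' →
      i = i' ∧ p = p' := by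
    intro i i' p p' v h h' hv hv'
    have e : p = p' := by
      by_contra e
      exact ht.pathsDisj p (hL h).1 p' (hL h').1 e v hv hv'
    exact ⟨getElem?_inj_of_nodup hLnd h (e ▸ h'), e⟩
  have hnotMem : ∀ {v}, v ∈ (G.shorten HV P).verts → v ∉ shortenCore G HV P →
      ∃ p ∈ P, 8 * P.card < p.length ∧ v ∈ p := by
    intro v hv hvA
    by_contra! hne
    exact hvA (Finset.mem_filter.2 ⟨hv, hne⟩)
  have hexists : ∀ v, ∃ i l, v ∈ (G.shorten HV P).verts → v ∉ shortenCore G HV P →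
      i < 2 * L.length ∧ 1 ≤ l ∧ l ≤ 4 * P.card ∧ IsTailVertex L i l v := by
    intro v
    by_cases hv : v ∈ (G.shorten HV P).verts ∧ v ∉ shortenCore G HV P
    swap
    · exact ⟨0, 0, fun h h' => (hv ⟨h, h'⟩).elim⟩
    obtain ⟨hv, hvA⟩ := hv
    obtain ⟨p, hp, hlen, hvp⟩ := hnotMem hv hvA
    obtain ⟨a, ha⟩ := List.mem_iff_getElem?.1 ((hLmem p).2 ⟨hp, hlen⟩)
    have haL := (List.getElem?_eq_some_iff.1 ha).1
    obtain ⟨q, hq, hvq⟩ : ∃ q ∈ P, v ∈ shortPath P.card q := by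
      rcases Finset.mem_union.1 (Finset.mem_inter.1 hv).2 with h | h
      · exact (ht.Hdisj p hp v hvp h).elim
      · obtain ⟨q, hq, hvq⟩ := Finset.mem_biUnion.1 h
        exact ⟨q, hq, List.mem_toFinset.1 hvq⟩
    obtain ⟨j, hj, hjm⟩ := mem_shortPath.1 hvq
    obtain rfl : p = q := by
      by_contra e
      exact ht.pathsDisj p hp q hq e v hvp (List.mem_of_getElem? hj)
    have hjl := (List.getElem?_eq_some_iff.1 hj).1
    rcases hjm hlen with hjm | hjm
    · exact ⟨2 * a, j + 1, fun _ _ => ⟨by omega, by omega, by omega, p, j,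
        by rwa [show 2 * a / 2 = a by omega], hj, by omega⟩⟩
    · exact ⟨2 * a + 1, p.length - j, fun _ _ => ⟨by omega, by omega, by omega, p, j,
        by rwa [show (2 * a + 1) / 2 = a by omega], hj, by omega⟩⟩
  have hroot : ∀ i, ∃ w, i < 2 * L.length → w ∈ HV ∧ ∃ x, IsTailVertex L i 1 x ∧ G.Adj x w ∧
      ∀ y ∈ HV, G.Adj x y → y = w := by
    intro i
    by_cases hi : i < 2 * L.length
    swap
    · exact ⟨default, fun h => (hi h).elim⟩
    have hp : L[i / 2]? = some L[i / 2] := List.getElem?_eq_getElem (by omega)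
    generalize L[i / 2] = p at hp
    obtain ⟨hpP, hlen⟩ := hL hp
    obtain ⟨j, hjl, hj⟩ : ∃ j < p.length, i % 2 = 0 ∧ j + 1 = 1 ∨ i % 2 = 1 ∧ j + 1 = p.length := by
      by_cases h : i % 2 = 0
      · exact ⟨0, by omega, by omega⟩
      · exact ⟨p.length - 1, by omega, by omega⟩
    have hx : p[j]? = some p[j] := List.getElem?_eq_getElem hjl
    obtain ⟨w, hw, h⟩ := ht.exists_root hpP (by omega) (by omega) hx
    exact ⟨w, fun _ => ⟨hw, _, ⟨p, j, hp, hx, hj⟩, h⟩⟩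
  choose en lev htail using hexists
  choose b hb using hroot
  refine ⟨2 * L.length, lev, en, b, by omega, Finset.filter_subset _ _, ?_, ?_, ?_, ?_, ?_, ?_⟩
  · intro i hi
    obtain ⟨hw, -⟩ := hb i hi
    refine Finset.mem_filter.2 ⟨Finset.mem_inter.2 ⟨ht.Hsub hw, Finset.mem_union_left _ hw⟩, ?_⟩
    intro p hp _ hbp
    exact ht.Hdisj p hp _ hbp hw
  · intro i hi i' hi' e
    obtain ⟨hw, x, ⟨p, j, hp, hx, hj⟩, hxw, -⟩ := hb i hi
    obtain ⟨-, x', ⟨p', j', hp', hx', hj'⟩, hxw', -⟩ := hb i' hi'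
    rw [← e] at hxw'
    obtain rfl := (ht.boundary _ hw x ⟨p, (hL hp).1, List.mem_of_getElem? hx⟩
      (adj_comm.1 hxw)).2 x' ⟨p', (hL hp').1, List.mem_of_getElem? hx'⟩ (adj_comm.1 hxw')
    obtain ⟨e1, rfl⟩ := hunique hp hp' (List.mem_of_getElem? hx) (List.mem_of_getElem? hx')
    have e2 := getElem?_inj_of_nodup (ht.paths p (hL hp).1).2.1 hx hx'
    have := (hL hp).2
    omega
  · intro v hv hvA
    obtain ⟨h1, h2, h3, -⟩ := htail v hv hvA
    exact ⟨h1, h2, h3⟩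
  · intro v hv hvA w hw hwA e1 e2
    obtain ⟨-, -, -, p, j, hp, hj, hpos⟩ := htail v hv hvA
    obtain ⟨-, -, -, p', j', hp', hj', hpos'⟩ := htail w hw hwA
    rw [← e1, hp] at hp'
    obtain rfl := Option.some_injective _ hp'
    obtain rfl : j = j' := by omega
    exact Option.some_injective _ (hj.symm.trans hj')
  · intro v hv hvA w hw hwA hadj
    obtain ⟨-, h2, h3, p, j, hp, hj, hpos⟩ := htail v hv hvA
    obtain ⟨-, h2', h3', p', j', hp', hj', hpos'⟩ := htail w hw hwA
    obtain ⟨hpP, hlen⟩ := hL hp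
    have hnd := (ht.paths p hpP).2.1
    have hvp := List.mem_of_getElem? hj
    have hwp' := List.mem_of_getElem? hj'
    have hjl := (List.getElem?_eq_some_iff.1 hj).1
    have hjl' := (List.getElem?_eq_some_iff.1 hj').1
    rcases adj_or_join_of_shorten_adj hadj with h | h
    · obtain rfl : p = p' := by
        by_contra e
        exact ht.noPathPathEdges p hpP p' (hL hp').1 e v hvp w hwp' h
      have e1 := (hunique hp hp' hvp hvp).1
      have := ht.index_of_adj hpP hj hj' h
      left
      omega
    · obtain ⟨q, hq, -, hvw⟩ := mem_of_mem_joinEdges hm h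
      have hvq : v ∈ q := by
        rcases hvw with ⟨h1, -⟩ | ⟨-, h1⟩ <;> exact List.mem_of_getElem? h1
      have hwq : w ∈ q := by
        rcases hvw with ⟨-, h1⟩ | ⟨h1, -⟩ <;> exact List.mem_of_getElem? h1
      obtain rfl : p = q := by
        by_contra e
        exact ht.pathsDisj p hpP q hq e v hvp hvq
      obtain ⟨e1, rfl⟩ := hunique hp hp' hwq hwp'
      right
      rcases hvw with ⟨h4, h5⟩ | ⟨h4, h5⟩
      · have := getElem?_inj_of_nodup hnd hj h4
        have := getElem?_inj_of_nodup hnd hj' h5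
        omega
      · have := getElem?_inj_of_nodup hnd hj h5
        have := getElem?_inj_of_nodup hnd hj' h4
        omega
  · intro v hv hvA w hwA hadj
    have h := adj_of_shorten_adj_of_mem_core hm hwA hadj
    obtain ⟨h1, h2, h3, p, j, hp, hj, hpos⟩ := htail v hv hvA
    obtain ⟨hpP, hlen⟩ := hL hp
    have hwH : w ∈ HV := (ht.mem_of_adj hpP (List.mem_of_getElem? hj) h).resolve_left
      ((Finset.mem_filter.1 hwA).2 p hpP hlen)
    have hend := ht.end_of_adj hpP hj hwH h
    have hlev : lev v = 1 := by omega
    obtain ⟨-, x, ⟨p', j', hp', hj', hpos'⟩, -, huniq⟩ := hb _ h1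
    rw [hp] at hp'
    obtain rfl := Option.some_injective _ hp'
    obtain rfl : j = j' := by omega
    obtain rfl := Option.some_injective _ (hj.symm.trans hj')
    exact ⟨hlev, huniq w hwH h⟩

theorem IsTidy.shorten_verts_nonempty [Inhabited V] (ht : IsTidy G HV P) :
    (G.shorten HV P).verts.Nonempty := by
  obtain ⟨p, hp⟩ := ht.Pne
  have hm : 0 < P.card := Finset.card_pos.2 ⟨p, hp⟩
  obtain ⟨x, l, rfl⟩ := List.exists_cons_of_ne_nil (ht.paths p hp).1
  refine ⟨x, Finset.mem_inter.2 ⟨((ht.paths _ hp).2.2.2 x List.mem_cons_self).1,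
    Finset.mem_union_right _ (Finset.mem_biUnion.2 ⟨_, hp, List.mem_toFinset.2
      (mem_shortPath.2 ⟨0, rfl, fun _ => Or.inl (by omega)⟩)⟩)⟩⟩

end Trigraph

/-- **Shortening the paths of a tidy `(H₀,𝒫₀)`-graph (Lemma 12).** Let `G` be a tidy
`(H₀,𝒫₀)`-graph with `tww(G) ≥ 3` and `m = |𝒫₀|`, and let `G'` be obtained from `G` by
shortening each path of `𝒫₀` with more than `8m` vertices to length exactly `8m - 1`. Then
`tww(G') ≤ tww(G) + 1`. -/
theorem tww_shorten {V : Type u} [Inhabited V] (G : Trigraph V) (HV : Finset V)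
    (P : Finset (List V)) (ht : IsTidy G HV P) (h3 : 3 ≤ G.tww) :
    (G.shorten HV P).tww ≤ G.tww + 1 := by
  obtain ⟨n, lev, en, b, hn, htail⟩ := ht.exists_isTailed
  obtain ⟨c, L, hc0, hm, hw, hL⟩ := exists_colourings (G := G) (by omega)
  have hsub : shortenCore G HV P ⊆ G.verts := fun x hx =>
    (Finset.mem_inter.1 (Finset.mem_filter.1 hx).1).1
  have hw' : ∀ s, QWidth (G.shorten HV P) (shortenCore G HV P) (c s) G.tww := by
    refine fun s => (hw s).restrict hsub (fun x _ y hy => adj_of_shorten_adj_of_mem_core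
      (Finset.card_pos.2 ht.Pne) hy) fun x hx y hy h => Finset.mem_filter.2 ⟨h, fun z hz => ?_⟩
    rcases Sym2.mem_iff.1 hz with rfl | rfl
    · exact (Finset.mem_inter.1 (Finset.mem_filter.1 hx).1).2
    · exact (Finset.mem_inter.1 (Finset.mem_filter.1 hy).1).2
  have h := htail.tww_le ht.shorten_verts_nonempty hn hm (by simp [hc0]) hw'
    fun x hx y hy => hL x (hsub hx) y (hsub hy)
  rwa [max_eq_left (by omega)] at h
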